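/- Suppose that for every sufficiently large α, u_α is a solution of problem (P_{α,λ*(α)}). Then, as α → ∞, ∫₀¹ u_α(r) r dr → 0 and ∫₀¹ ψ(r) f(u_α(r)) r dr → f(0) ∫₀¹ ψ(r) r dr (equivalently, in Cartesian coordinates on the unit disk B, ∫_B u_α dx → 0 and ∫_B ψ f(u_α) dx → f(0) ∫_B ψ dx for the radially symmetric extensions). -/

import Mathlib

open Set MeasureTheory Filter

/-- The standing data and assumptions of the Gelfand-type problem for
auto-ignition of a free round turbulent jet:
`f : [0,∞) → (0,∞)` is `C¹`, convex, non-decreasing with `K = ∫₀^∞ ds / f s < ∞`;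
`φ, ψ : [0,1] → [0,∞)` are non-increasing Lipschitz with `φ 0 = ψ 0 = 1`,
`φ > 0` on `[0,1)`, and `M s = max_{r ∈ [0,s]} ψ r / φ r` is integrable on `(0,1)`. -/
structure GelfandData where
  f : ℝ → ℝ
  phi : ℝ → ℝ
  psi : ℝ → ℝ
  M : ℝ → ℝ
  K : ℝ
  f_pos : ∀ s, 0 ≤ s → 0 < f s
  f_smooth : ContDiffOn ℝ 1 f (Ici 0)
  f_convex : ConvexOn ℝ (Ici 0) f
  f_mono : MonotoneOn f (Ici 0)
  f_int : IntegrableOn (fun s => 1 / f s) (Ioi 0)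
  K_def : K = ∫ s in Ioi (0:ℝ), 1 / f s
  phi_nonneg : ∀ r ∈ Icc (0:ℝ) 1, 0 ≤ phi r
  psi_nonneg : ∀ r ∈ Icc (0:ℝ) 1, 0 ≤ psi r
  phi_anti : AntitoneOn phi (Icc 0 1)
  psi_anti : AntitoneOn psi (Icc 0 1)
  phi_lip : ∃ L, LipschitzOnWith L phi (Icc 0 1)
  psi_lip : ∃ L, LipschitzOnWith L psi (Icc 0 1)
  phi_zero : phi 0 = 1
  psi_zero : psi 0 = 1
  phi_pos : ∀ r ∈ Ico (0:ℝ) 1, 0 < phi r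
  M_def : ∀ s ∈ Ico (0:ℝ) 1, IsGreatest ((fun r => psi r / phi r) '' Icc 0 s) (M s)
  M_int : IntegrableOn M (Ioo 0 1)

/-- `u` is a (classical, radial) solution of problem `(P_{α,λ})`:
`u ∈ C²((0,1)) ∩ C¹([0,1])`, `u > 0` on `[0,1)`, `u'(0) = 0`, `u 1 = 0`, and
`-u'' - (1/r + α r φ(r)) u' = λ ψ(r) f(u(r))` on `(0,1)`. -/
def IsSolution (D : GelfandData) (α lam : ℝ) (u : ℝ → ℝ) : Prop :=
  ContDiffOn ℝ 1 u (Icc 0 1) ∧ ContDiffOn ℝ 2 u (Ioo 0 1) ∧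
  (∀ r ∈ Ico (0:ℝ) 1, 0 < u r) ∧
  derivWithin u (Icc 0 1) 0 = 0 ∧ u 1 = 0 ∧
  ∀ r ∈ Ioo (0:ℝ) 1,
    -(derivWithin (derivWithin u (Icc 0 1)) (Ioo 0 1) r)
      - (1 / r + α * r * D.phi r) * derivWithin u (Icc 0 1) r
      = lam * D.psi r * D.f (u r)

/-- The set of `λ > 0` for which problem `(P_{α,λ})` admits a solution. -/
def solvableSet (D : GelfandData) (α : ℝ) : Set ℝ :=
  {lam | 0 < lam ∧ ∃ u, IsSolution D α lam u}

/-- The extremal Frank-Kamenetskii parameter `λ*(α)`. -/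
noncomputable def lamStar (D : GelfandData) (α : ℝ) : ℝ := sSup (solvableSet D α)

/-- The weight `μ(r) = exp(α ∫₀^r s φ(s) ds)`. -/
noncomputable def muW (D : GelfandData) (α r : ℝ) : ℝ :=
  Real.exp (α * ∫ s in (0:ℝ)..r, s * D.phi s)

/-- `u` is a semistable solution: for every `C¹` test function `η` with `η 1 = 0`,
`∫₀¹ η'^2 μ r dr ≥ λ ∫₀¹ ψ f'(u) η² μ r dr`. -/
def IsSemistable (D : GelfandData) (α lam : ℝ) (u : ℝ → ℝ) : Prop :=
  ∀ η : ℝ → ℝ, ContDiff ℝ 1 η → η 1 = 0 →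
    lam * ∫ r in Ioo (0:ℝ) 1,
        D.psi r * derivWithin D.f (Ici 0) (u r) * (η r) ^ 2 * muW D α r * r
      ≤ ∫ r in Ioo (0:ℝ) 1, (deriv η r) ^ 2 * muW D α r * r


namespace Gel

lemma le_of_deriv_le {h k h' k' : ℝ → ℝ} {a b : ℝ} (hab : a ≤ b)
    (hc : ContinuousOn h (Icc a b)) (kc : ContinuousOn k (Icc a b))
    (hd : ∀ x ∈ Ioo a b, HasDerivAt h (h' x) x) (kd : ∀ x ∈ Ioo a b, HasDerivAt k (k' x) x)
    (hle : ∀ x ∈ Ioo a b, h' x ≤ k' x) : h b - h a ≤ k b - k a := by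
  have hm : MonotoneOn (fun x => k x - h x) (Icc a b) := by
    apply monotoneOn_of_deriv_nonneg (convex_Icc a b) (kc.sub hc)
    · intro x hx
      rw [interior_Icc] at hx
      exact ((kd x hx).sub (hd x hx)).differentiableAt.differentiableWithinAt
    · intro x hx
      rw [interior_Icc] at hx
      have := ((kd x hx).sub (hd x hx)).deriv
      rw [this]; linarith [hle x hx]
  have := hm (left_mem_Icc.2 hab) (right_mem_Icc.2 hab) hab
  simp only at this
  linarith

noncomputable def cl (x : ℝ) : ℝ := max 0 (min 1 x)

lemma cl_cont : Continuous cl := by unfold cl; fun_prop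
lemma cl_mem (x : ℝ) : cl x ∈ Icc (0:ℝ) 1 :=
  ⟨le_max_left _ _, max_le zero_le_one (min_le_left _ _)⟩
lemma cl_eq {x : ℝ} (h : x ∈ Icc (0:ℝ) 1) : cl x = x := by
  unfold cl; rw [min_eq_right h.2, max_eq_right h.1]
lemma cl_mono : Monotone cl := by
  intro x y h; unfold cl; gcongr

noncomputable def ph (D : GelfandData) (x : ℝ) : ℝ := D.phi (cl x)
noncomputable def ps (D : GelfandData) (x : ℝ) : ℝ := D.psi (cl x)
noncomputable def ff (D : GelfandData) (x : ℝ) : ℝ := D.f (max 0 x)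

variable (D : GelfandData)

lemma ph_eq {x : ℝ} (h : x ∈ Icc (0:ℝ) 1) : ph D x = D.phi x := by unfold ph; rw [cl_eq h]
lemma ps_eq {x : ℝ} (h : x ∈ Icc (0:ℝ) 1) : ps D x = D.psi x := by unfold ps; rw [cl_eq h]
lemma ff_eq {x : ℝ} (h : 0 ≤ x) : ff D x = D.f x := by unfold ff; rw [max_eq_right h]

lemma ph_cont : Continuous (ph D) := by
  obtain ⟨L, hL⟩ := D.phi_lip
  exact hL.continuousOn.comp_continuous cl_cont cl_mem
lemma ps_cont : Continuous (ps D) := by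
  obtain ⟨L, hL⟩ := D.psi_lip
  exact hL.continuousOn.comp_continuous cl_cont cl_mem
lemma ff_cont : Continuous (ff D) :=
  D.f_smooth.continuousOn.comp_continuous (by fun_prop) (fun x => mem_Ici.2 (le_max_left _ _))
lemma ff_mono : Monotone (ff D) := by
  intro x y h
  exact D.f_mono (mem_Ici.2 (le_max_left _ _)) (mem_Ici.2 (le_max_left _ _)) (by gcongr)
lemma ff_pos (x : ℝ) : 0 < ff D x := D.f_pos _ (le_max_left _ _)
lemma ff_zero_le (x : ℝ) : ff D 0 ≤ ff D x :=
  D.f_mono (mem_Ici.2 (le_max_left _ _)) (mem_Ici.2 (le_max_left _ _)) (by simp)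
lemma ph_nonneg (x : ℝ) : 0 ≤ ph D x := D.phi_nonneg _ (cl_mem x)
lemma ps_nonneg (x : ℝ) : 0 ≤ ps D x := D.psi_nonneg _ (cl_mem x)
lemma ph_le (x : ℝ) : ph D x ≤ 1 := by
  rw [← D.phi_zero]; exact D.phi_anti (by simp) (cl_mem x) (cl_mem x).1
lemma ps_le (x : ℝ) : ps D x ≤ 1 := by
  rw [← D.psi_zero]; exact D.psi_anti (by simp) (cl_mem x) (cl_mem x).1

/-- near zero the coefficients are close to one -/
lemma exists_r0 {ε : ℝ} (hε : 0 < ε) : ∃ r0 ∈ Ioo (0:ℝ) 1, ∀ r ≤ r0, 1 - ε ≤ ph D r ∧ 1 - ε ≤ ps D r := by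
  have h1 : ∀ᶠ x in nhds (0:ℝ), 1 - ε < ph D x := by
    apply (ph_cont D).continuousAt.eventually (lt_mem_nhds _)
    rw [ph_eq D (by simp), D.phi_zero]; linarith
  have h2 : ∀ᶠ x in nhds (0:ℝ), 1 - ε < ps D x := by
    apply (ps_cont D).continuousAt.eventually (lt_mem_nhds _)
    rw [ps_eq D (by simp), D.psi_zero]; linarith
  obtain ⟨δ, hδ, h⟩ := Metric.eventually_nhds_iff.1 (h1.and h2)
  refine ⟨min (δ/2) (1/2), ⟨by positivity, by
    exact lt_of_le_of_lt (min_le_right _ _) (by norm_num)⟩, ?_⟩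
  have hm : min (δ/2) (1/2) < δ := lt_of_le_of_lt (min_le_left _ _) (by linarith)
  have h0 : 0 < min (δ/2) (1/2) := by positivity
  intro r hr
  have h' := @h (min (δ/2) (1/2)) (by rw [Real.dist_eq, sub_zero, abs_of_pos h0]; exact hm)
  constructor
  · exact h'.1.le.trans (D.phi_anti (cl_mem r) (cl_mem _) (cl_mono hr))
  · exact h'.2.le.trans (D.psi_anti (cl_mem r) (cl_mem _) (cl_mono hr))

noncomputable def mu (α r : ℝ) : ℝ := Real.exp (α * ∫ s in (0:ℝ)..r, s * ph D s)

lemma mu_pos (α r : ℝ) : 0 < mu D α r := Real.exp_pos _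
lemma mu_zero (α : ℝ) : mu D α 0 = 1 := by simp [mu]
lemma mu_deriv (α r : ℝ) : HasDerivAt (mu D α) (α * r * ph D r * mu D α r) r := by
  have hc : Continuous (fun s => s * ph D s) := continuous_id.mul (ph_cont D)
  have := ((intervalIntegral.integral_hasDerivAt_right (hc.intervalIntegrable 0 r)
    (hc.stronglyMeasurableAtFilter _ _) hc.continuousAt).const_mul α).exp
  exact HasDerivAt.congr_deriv this (by unfold mu; ring)
lemma mu_cont (α : ℝ) : Continuous (mu D α) :=
  continuous_iff_continuousAt.2 fun r => (mu_deriv D α r).continuousAt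
lemma mu_mono {α : ℝ} (hα : 0 < α) : MonotoneOn (mu D α) (Ici 0) := by
  intro x hx y hy hxy
  have := le_of_deriv_le (h := fun _ => 0) (h' := fun _ => 0) hxy continuousOn_const
    (mu_cont D α).continuousOn (fun x _ => hasDerivAt_const x 0) (fun x _ => mu_deriv D α x)
    (fun t ht => by
      have : 0 ≤ t := le_trans hx ht.1.le
      have := ph_nonneg D t
      have := mu_pos D α t
      positivity)
  linarith
lemma mu_ge_one {α r : ℝ} (hα : 0 < α) (hr : 0 ≤ r) : 1 ≤ mu D α r := by
  rw [← mu_zero D α]; exact mu_mono D hα (by simp) hr hr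
lemma mu_lower {α r r0 : ℝ} (hα : 0 < α) (hr : 0 ≤ r) (hr0 : r ≤ r0)
    (h : ∀ r ≤ r0, 1/2 ≤ ph D r) : 1 + α * r^2 / 4 ≤ mu D α r := by
  have := le_of_deriv_le (h := fun x => α * x^2/4) (h' := fun x => α * x / 2) hr
    (by fun_prop)
    (mu_cont D α).continuousOn (fun x _ => by
      have := (((hasDerivAt_id x).pow 2).const_mul α).div_const 4
      exact HasDerivAt.congr_deriv this (by simp; ring))
    (fun x _ => mu_deriv D α x)
    (fun t ht => by
      have h1 := h t (by linarith [ht.2])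
      have h2 := mu_ge_one D hα ht.1.le
      have : 0 < α * t := mul_pos hα ht.1
      have : 1/2 * 1 ≤ ph D t * mu D α t := mul_le_mul h1 h2 (by norm_num) (by linarith)
      nlinarith)
  rw [mu_zero] at this
  simp at this
  linarith

noncomputable def FF (x : ℝ) : ℝ := ∫ s in (0:ℝ)..x, 1 / ff D s

lemma FF_deriv (x : ℝ) : HasDerivAt (FF D) (1 / ff D x) x := by
  have hc : Continuous (fun s => 1 / ff D s) :=
    continuous_const.div (ff_cont D) (fun x => (ff_pos D x).ne')
  exact (intervalIntegral.integral_hasDerivAt_right (hc.intervalIntegrable 0 x)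
    (hc.stronglyMeasurableAtFilter _ _) hc.continuousAt)
lemma FF_zero : FF D 0 = 0 := by simp [FF]
lemma FF_cont : Continuous (FF D) :=
  continuous_iff_continuousAt.2 fun r => (FF_deriv D r).continuousAt
lemma FF_strictMono : StrictMono (FF D) := by
  apply strictMono_of_deriv_pos
  intro x; rw [(FF_deriv D x).deriv]; have := ff_pos D x; positivity
lemma FF_tendsto : Tendsto (FF D) atTop (nhds D.K) := by
  rw [D.K_def]
  have := intervalIntegral_tendsto_integral_Ioi 0 D.f_int tendsto_id
  refine this.congr' ?_
  filter_upwards [eventually_ge_atTop 0] with x hx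
  unfold FF
  apply intervalIntegral.integral_congr
  intro s hs
  rw [id, uIcc_of_le hx] at hs
  simp only [ff_eq D hs.1]
lemma FF_lt (x : ℝ) : FF D x < D.K := by
  have h1 : FF D (x+1) ≤ D.K := (FF_strictMono D).monotone.ge_of_tendsto (FF_tendsto D) _
  exact (FF_strictMono D (by linarith : x < x+1)).trans_le h1
lemma K_pos : 0 < D.K := by
  have := FF_lt D 0; rwa [FF_zero] at this
lemma FF_ge {x : ℝ} (hx : 0 ≤ x) : x / ff D x ≤ FF D x := by
  have := le_of_deriv_le (h := fun t => t / ff D x) (h' := fun _ => 1 / ff D x) hx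
    (by fun_prop) (FF_cont D).continuousOn (fun t _ => (hasDerivAt_id t).div_const _)
    (fun t _ => FF_deriv D t)
    (fun t ht => by
      apply one_div_le_one_div_of_le (ff_pos D t) (ff_mono D ht.2.le))
  simp [FF_zero] at this
  exact this

lemma ff_convex : ConvexOn ℝ (Ici 0) (ff D) :=
  D.f_convex.congr (fun _ hx => (ff_eq D hx).symm)

/-- superlinear growth -/
lemma superlin {A : ℝ} (hA : 0 < A) : ∀ᶠ s in atTop, A * s * Real.log s ≤ ff D s := by
  have hK := K_pos D
  have hs : Tendsto (fun s:ℝ => Real.sqrt s) atTop atTop := Real.tendsto_sqrt_atTop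
  have h1 : Tendsto (fun s => FF D s - FF D (Real.sqrt s)) atTop (nhds (D.K - D.K)) :=
    (FF_tendsto D).sub ((FF_tendsto D).comp hs)
  rw [sub_self] at h1
  have h2 : ∀ᶠ s in atTop, FF D s - FF D (Real.sqrt s) < 1 / (4 * A) :=
    h1.eventually (gt_mem_nhds (by positivity))
  -- f s ≥ s / K
  have h0 := ff_pos D 0
  filter_upwards [h2, eventually_gt_atTop 1, hs.eventually_ge_atTop (2 * D.K * ff D 0),
    eventually_ge_atTop (2 * D.K * ff D 0)] with s hs1 hs2 hs3 hs4
  have hspos : 0 < s := by linarith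
  have hfs : s / D.K ≤ ff D s := by
    have := FF_ge D hspos.le
    have h3 := (FF_lt D s).le
    have h4 : s / ff D s ≤ D.K := this.trans h3
    rw [div_le_iff₀ (ff_pos D s)] at h4
    rw [div_le_iff₀ hK]; linarith
  set g := (ff D s - ff D 0) / s with hg
  have hgl : 1 / (2 * D.K) ≤ g := by
    rw [hg, le_div_iff₀ hspos]
    have : ff D 0 ≤ s / (2 * D.K) := by rw [le_div_iff₀ (by positivity)]; linarith
    have e : s / D.K = s/(2*D.K) + s/(2*D.K) := by field_simp; ring
    have e2 : 1 / (2 * D.K) * s = s/(2*D.K) := by ring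
    linarith
  have hgpos : 0 < g := lt_of_lt_of_le (by positivity) hgl
  have hsq : 0 < Real.sqrt s := Real.sqrt_pos.2 hspos
  have hsq1 : Real.sqrt s ≤ s := by
    rw [Real.sqrt_le_left hspos.le]; nlinarith
  have key := le_of_deriv_le (h := fun t => Real.log t / (2*g)) (h' := fun t => t⁻¹ / (2*g)) hsq1
    (by
      apply ContinuousOn.div_const
      apply Real.continuousOn_log.mono
      intro t ht; have : 0 < t := lt_of_lt_of_le hsq ht.1
      simpa using this.ne')
    (FF_cont D).continuousOn
    (fun t ht => by
      have : 0 < t := lt_trans hsq ht.1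
      exact (Real.hasDerivAt_log this.ne').div_const _)
    (fun t _ => FF_deriv D t)
    (fun t ht => by
      have htp : 0 < t := lt_trans hsq ht.1
      rw [inv_eq_one_div, div_div]
      apply one_div_le_one_div_of_le (ff_pos D t)
      have hconv := (ff_convex D).2 (show (0:ℝ) ∈ Ici 0 by simp) (show s ∈ Ici (0:ℝ) from hspos.le)
        (show 0 ≤ 1 - t/s by rw [sub_nonneg, div_le_one hspos]; exact ht.2.le)
        (show 0 ≤ t/s by positivity) (by ring)
      simp only [smul_eq_mul, mul_zero, zero_add, div_mul_cancel₀ _ hspos.ne'] at hconv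
      have e : (1 - t/s) * ff D 0 + t/s * ff D s = ff D 0 + t * g := by rw [hg]; field_simp; ring
      have : ff D 0 ≤ t * g := by
        have h5 : 2 * D.K * ff D 0 * (1/(2*D.K)) ≤ t * g :=
          mul_le_mul (by linarith [ht.1]) hgl (by positivity) htp.le
        have e : 2 * D.K * ff D 0 * (1/(2*D.K)) = ff D 0 := by field_simp
        linarith
      linarith)
  rw [Real.log_sqrt hspos.le] at key
  have hlog : 0 < Real.log s := Real.log_pos hs2
  have h6 : Real.log s / (4 * g) < 1 / (4*A) := by
    have : Real.log s / (2*g) - Real.log s / 2 / (2*g) = Real.log s / (4*g) := by field_simp; ring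
    linarith
  rw [div_lt_div_iff₀ (by positivity) (by positivity)] at h6
  have h7 : A * Real.log s ≤ g := by linarith
  have h8 : g * s = ff D s - ff D 0 := by rw [hg]; field_simp
  nlinarith

structure Sol (α lam : ℝ) (u v : ℝ → ℝ) : Prop where
  uc : ContinuousOn u (Icc 0 1)
  vc : ContinuousOn v (Icc 0 1)
  v0 : v 0 = 0
  u1 : u 1 = 0
  upos : ∀ r ∈ Icc (0:ℝ) 1, 0 ≤ u r
  ud : ∀ r ∈ Ioo (0:ℝ) 1, HasDerivAt u (v r) r
  vd : ∀ r ∈ Ioo (0:ℝ) 1, HasDerivAt v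
    (-(1 / r + α * r * ph D r) * v r - lam * ps D r * ff D (u r)) r

lemma sol_of {α lam : ℝ} {u : ℝ → ℝ} (h : IsSolution D α lam u) : ∃ v, Sol D α lam u v := by
  obtain ⟨h1, h2, h3, h4, h5, h6⟩ := h
  have hnn : ∀ r ∈ Icc (0:ℝ) 1, 0 ≤ u r := by
    intro r hr
    rcases eq_or_lt_of_le hr.2 with h | h
    · rw [h, h5]
    · exact (h3 r ⟨hr.1, h⟩).le
  have hvd : ∀ r ∈ Ioo (0:ℝ) 1, derivWithin u (Icc 0 1) r = deriv u r := by
    intro r hr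
    exact derivWithin_of_mem_nhds (Icc_mem_nhds hr.1 hr.2)
  refine ⟨derivWithin u (Icc 0 1), h1.continuousOn,
    h1.continuousOn_derivWithin (uniqueDiffOn_Icc zero_lt_one) le_rfl, h4, h5, hnn, ?_, ?_⟩
  · intro r hr
    rw [hvd r hr]
    exact ((h2.contDiffAt (Ioo_mem_nhds hr.1 hr.2)).differentiableAt (by norm_num)).hasDerivAt
  · intro r hr
    have hd2 : DifferentiableAt ℝ (deriv u) r := by
      have : ContDiffOn ℝ 1 (deriv u) (Ioo 0 1) := by
        have h2' : ContDiffOn ℝ (1+1) u (Ioo 0 1) := by norm_num; exact h2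
        exact ((contDiffOn_succ_iff_deriv_of_isOpen isOpen_Ioo).1 h2').2.2
      exact (this.contDiffAt (Ioo_mem_nhds hr.1 hr.2)).differentiableAt (by norm_num)
    have hev : derivWithin u (Icc 0 1) =ᶠ[nhds r] deriv u := by
      filter_upwards [Ioo_mem_nhds hr.1 hr.2] with x hx using hvd x hx
    have hd3 : DifferentiableAt ℝ (derivWithin u (Icc 0 1)) r := hd2.congr_of_eventuallyEq hev
    have h6' := h6 r hr
    rw [derivWithin_of_mem_nhds (Ioo_mem_nhds hr.1 hr.2)] at h6'
    refine hd3.hasDerivAt.congr_deriv ?_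
    rw [ph_eq D ⟨hr.1.le, hr.2.le⟩, ps_eq D ⟨hr.1.le, hr.2.le⟩, ff_eq D (hnn r ⟨hr.1.le, hr.2.le⟩)]
    linarith

variable {D}
variable {α lam : ℝ} {u v : ℝ → ℝ}

lemma Sol.flux (h : Sol D α lam u v) {r : ℝ} (hr : r ∈ Ioo (0:ℝ) 1) :
    HasDerivAt (fun s => -(s * mu D α s * v s)) (lam * r * mu D α r * ps D r * ff D (u r)) r := by
  have h1 := (((hasDerivAt_id r).mul (mu_deriv D α r)).mul (h.vd r hr)).neg
  refine h1.congr_deriv ?_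
  have := hr.1.ne'
  simp
  field_simp
  ring

lemma Sol.flux_cont (h : Sol D α lam u v) {r : ℝ} (hr : r ≤ 1) :
    ContinuousOn (fun s => -(s * mu D α s * v s)) (Icc 0 r) := by
  have := (mu_cont D α).continuousOn (s := Icc 0 r)
  have := h.vc.mono (Icc_subset_Icc_right hr)
  fun_prop

lemma Sol.v_nonpos (h : Sol D α lam u v) (hl : 0 ≤ lam) {r : ℝ} (hr : r ∈ Icc (0:ℝ) 1) :
    v r ≤ 0 := by
  rcases eq_or_lt_of_le hr.1 with h0 | h0
  · rw [← h0, h.v0]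
  have := le_of_deriv_le (h := fun _ => 0) (h' := fun _ => 0) hr.1 continuousOn_const
    (h.flux_cont hr.2) (fun x _ => hasDerivAt_const x 0)
    (fun x hx => h.flux ⟨hx.1, hx.2.trans_le hr.2⟩)
    (fun t ht => by
      have := ht.1.le
      have := mu_pos D α t
      have := ps_nonneg D t
      have := ff_pos D (u t)
      positivity)
  simp at this
  have hm := mu_pos D α r
  have : 0 < r * mu D α r := by positivity
  by_contra hc
  push Not at hc
  nlinarith [mul_pos this hc]

lemma Sol.anti (h : Sol D α lam u v) (hl : 0 ≤ lam) : AntitoneOn u (Icc 0 1) := by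
  intro x hx y hy hxy
  have := le_of_deriv_le (k := fun _ => 0) (k' := fun _ => 0) hxy
    (h.uc.mono (Icc_subset_Icc hx.1 hy.2)) continuousOn_const
    (fun t ht => h.ud t ⟨hx.1.trans_lt ht.1, ht.2.trans_le hy.2⟩)
    (fun x _ => hasDerivAt_const x 0)
    (fun t ht => h.v_nonpos hl ⟨hx.1.trans ht.1.le, ht.2.le.trans hy.2⟩)
  simp at this
  exact this

lemma Sol.flux_lower (h : Sol D α lam u v) (hl : 0 ≤ lam) (hα : 0 < α) {ε r0 r : ℝ}
    (hε : ε ≤ 1) (hr1 : r0 < 1)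
    (hr0 : ∀ r ≤ r0, 1 - ε ≤ ps D r) (hr : 0 ≤ r) (hrr : r ≤ r0) :
    lam * (1 - ε) * ff D (u r) * ((mu D α r - 1) / α) ≤ -(r * mu D α r * v r) := by
  have hmc := (mu_cont D α).continuousOn (s := Icc 0 r)
  have := le_of_deriv_le (h := fun s => lam * (1 - ε) * ff D (u r) * ((mu D α s - 1) / α))
    (h' := fun s => lam * (1 - ε) * ff D (u r) * ((α * s * ph D s * mu D α s) / α)) hr
    (by fun_prop)
    (h.flux_cont (by linarith))
    (fun x _ => (((mu_deriv D α x).sub_const 1).div_const α).const_mul _)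
    (fun x hx => h.flux ⟨hx.1, by linarith [hx.2]⟩)
    (fun t ht => by
      have ht0 := ht.1
      have htr : t ≤ 1 := by linarith [ht.2]
      have h1 := mu_pos D α t
      have h2 := hr0 t (by linarith [ht.2])
      have h3 := ff_pos D (u r)
      have h4 : ff D (u r) ≤ ff D (u t) := ff_mono D (h.anti hl ⟨ht0.le, htr⟩ ⟨hr, by linarith⟩ ht.2.le)
      have h5 := ph_le D t
      have h6 := ph_nonneg D t
      have e : lam * (1 - ε) * ff D (u r) * ((α * t * ph D t * mu D α t) / α) =
        lam * t * mu D α t * (((1 - ε) * ph D t) * ff D (u r)) := by field_simp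
      have e2 : lam * t * mu D α t * ps D t * ff D (u t) = lam * t * mu D α t * (ps D t * ff D (u t)) := by ring
      rw [e, e2]
      have h7 : (1 - ε) * ph D t ≤ ps D t := by nlinarith
      have h8 := ps_nonneg D t
      gcongr)
  simp [mu_zero] at this
  linarith

/-- basic a priori estimate -/
lemma Sol.apriori (h : Sol D α lam u v) (hl : 0 ≤ lam) (hα : 0 < α) {ε r0 r : ℝ}
    (hε : ε ≤ 1/2) (hr1 : r0 < 1)
    (hr0 : ∀ r ≤ r0, 1 - ε ≤ ph D r ∧ 1 - ε ≤ ps D r) (hr : 0 ≤ r) (hrr : r ≤ r0) :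
    FF D (u r) + lam * (1 - ε) / (2 * α) * Real.log (1 + α * r^2/4) ≤ D.K := by
  have := le_of_deriv_le (h := fun s => lam * (1 - ε) / (2 * α) * Real.log (1 + α * s^2/4))
    (h' := fun s => lam * (1 - ε) / (2 * α) * ((α * s / 2) / (1 + α * s^2/4)))
    (k := fun s => - FF D (u s)) (k' := fun s => - (1 / ff D (u s) * v s)) hr
    (by
      apply ContinuousOn.mul continuousOn_const
      apply ContinuousOn.log (by fun_prop)
      intro x hx; positivity)
    (((FF_cont D).comp_continuousOn (h.uc.mono (Icc_subset_Icc_right (by linarith)))).neg)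
    (fun x hx => by
      apply HasDerivAt.const_mul
      have h0 : HasDerivAt (fun s:ℝ => 1 + α * s^2/4) (α * x / 2) x := by
        have := ((((hasDerivAt_id x).pow 2).const_mul α).div_const 4).const_add 1
        exact HasDerivAt.congr_deriv this (by simp; ring)
      exact h0.log (by positivity))
    (fun x hx => ((FF_deriv D (u x)).comp x (h.ud x ⟨hx.1, by linarith [hx.2]⟩)).neg)
    (fun t ht => by
      have ht0 := ht.1
      have htr : t ≤ r0 := by linarith [ht.2]
      have h1 := h.flux_lower hl hα (by linarith : ε ≤ 1) hr1 (fun r hr => (hr0 r hr).2) ht0.le htr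
      have h2 := mu_lower D hα ht0.le htr (fun r hr => by linarith [(hr0 r hr).1])
      have h3 := ff_pos D (u t)
      have hm := mu_pos D α t
      have h4 : α * t^2/4 / (1 + α * t^2/4) ≤ (mu D α t - 1) / mu D α t := by
        rw [div_le_div_iff₀ (by positivity) hm]; nlinarith
      have e1 : lam * (1 - ε) / (2 * α) * ((α * t / 2) / (1 + α * t^2/4)) =
          lam * (1 - ε) / (α * t) * (α * t^2/4 / (1 + α * t^2/4)) := by
        field_simp; ring
      have h5 : 0 ≤ lam * (1 - ε) / (α * t) :=
        div_nonneg (mul_nonneg hl (by linarith)) (by positivity)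
      rw [e1]
      refine (mul_le_mul_of_nonneg_left h4 h5).trans ?_
      have e2 : lam * (1 - ε) / (α * t) * ((mu D α t - 1) / mu D α t) =
        (lam * (1 - ε) * ff D (u t) * ((mu D α t - 1) / α)) / (t * mu D α t * ff D (u t)) := by
        field_simp
      have e3 : - (1 / ff D (u t) * v t) = (-(t * mu D α t * v t)) / (t * mu D α t * ff D (u t)) := by
        field_simp
      rw [e2, e3]
      gcongr)
  simp at this
  linarith [FF_lt D (u 0)]

/-- test function estimate -/
lemma Sol.test (h : Sol D α lam u v) (hl : 0 ≤ lam) (hα : 0 < α) {R : ℝ} (hR : 0 < R) (hR1 : R < 1) :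
    ∫ r in (0:ℝ)..R, (lam * ps D r * ff D (u r) * (1 - r^2/R^2) * r
      - u r * r * (4/R^2 + 2 * α * (1 - r^2/R^2))) ≤ 0 := by
  have huc : ContinuousOn u (Icc 0 R) := h.uc.mono (Icc_subset_Icc_right hR1.le)
  have hvc : ContinuousOn v (Icc 0 R) := h.vc.mono (Icc_subset_Icc_right hR1.le)
  have hpc := (ps_cont D).continuousOn (s := Icc 0 R)
  have hfc := (ff_cont D).comp_continuousOn huc
  set w : ℝ → ℝ := fun r => (lam * ps D r * ff D (u r) * (1 - r^2/R^2) * r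
      - u r * r * (4/R^2 + 2 * α * (1 - r^2/R^2))) with hw
  have hfc' : ContinuousOn (fun r => ff D (u r)) (Icc 0 R) := hfc
  have hwc : ContinuousOn w (Icc 0 R) := by
    rw [hw]; fun_prop
  have hwi : IntervalIntegrable w volume 0 R := by
    apply ContinuousOn.intervalIntegrable; rwa [uIcc_of_le hR.le]
  have := le_of_deriv_le (h := fun x => ∫ r in (0:ℝ)..x, w r)
    (h' := w)
    (k := fun r => -(r * v r) * (1 - r^2/R^2) + r * u r * (-(2*r/R^2)) - α * r^2 * u r * (1 - r^2/R^2))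
    (k' := fun r => -(1 * v r + r * (-(1 / r + α * r * ph D r) * v r - lam * ps D r * ff D (u r))) * (1 - r^2/R^2)
      + -(r * v r) * (-(2*r/R^2)) + ((1 * u r + r * v r) * (-(2*r/R^2)) + r * u r * (-(2/R^2)))
      - ((α * (2 * r) * u r + α * r^2 * v r) * (1 - r^2/R^2) + α * r^2 * u r * (-(2*r/R^2)))) hR.le
    (by
      have := intervalIntegral.continuousOn_primitive_interval' hwi (left_mem_uIcc)
      rwa [uIcc_of_le hR.le] at this)
    (by fun_prop)
    (fun x hx => by
      have hn : Icc 0 R ∈ nhds x := Icc_mem_nhds hx.1 hx.2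
      apply intervalIntegral.integral_hasDerivAt_right
      · exact hwi.mono_set (by
          rw [uIcc_of_le hR.le, uIcc_of_le hx.1.le]; exact Icc_subset_Icc_right hx.2.le)
      · exact ContinuousOn.stronglyMeasurableAtFilter_nhdsWithin hwc measurableSet_Icc x |>.filter_mono (by
          rw [nhdsWithin_eq_nhds.2 hn])
      · exact hwc.continuousAt hn)
    (fun x hx => by
      have hx1 : x ∈ Ioo (0:ℝ) 1 := ⟨hx.1, hx.2.trans hR1⟩
      have a1 := h.ud x hx1
      have a2 := h.vd x hx1
      have a3 : HasDerivAt (fun r:ℝ => 1 - r^2/R^2) (-(2*x/R^2)) x := by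
        have := (((hasDerivAt_id x).pow 2).div_const (R^2)).const_sub 1
        exact HasDerivAt.congr_deriv this (by simp)
      have a4 : HasDerivAt (fun r:ℝ => -(2*r/R^2)) (-(2/R^2)) x := by
        have := (((hasDerivAt_id x).const_mul 2).div_const (R^2)).neg
        exact HasDerivAt.congr_deriv this (by simp)
      have a5 : HasDerivAt (fun r:ℝ => α * r^2) (α * (2*x)) x := by
        have := (((hasDerivAt_id x).pow 2).const_mul α)
        exact HasDerivAt.congr_deriv this (by simp)
      exact (((((hasDerivAt_id x).mul a2).neg.mul a3).add
        (((hasDerivAt_id x).mul a1).mul a4)).sub ((a5.mul a1).mul a3)))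
    (fun t ht => by
      have ht0 := ht.1
      have hv := h.v_nonpos hl ⟨ht0.le, (ht.2.trans hR1).le⟩
      have hu := h.upos t ⟨ht0.le, (ht.2.trans hR1).le⟩
      have hp := ph_le D t
      have hη : 0 ≤ 1 - t^2/R^2 := by
        rw [sub_nonneg, div_le_one (by positivity)]
        have := ht.2; gcongr
      have e : -(1 * v t + t * (-(1 / t + α * t * ph D t) * v t - lam * ps D t * ff D (u t))) * (1 - t^2/R^2)
      + -(t * v t) * (-(2*t/R^2)) + ((1 * u t + t * v t) * (-(2*t/R^2)) + t * u t * (-(2/R^2)))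
      - ((α * (2 * t) * u t + α * t^2 * v t) * (1 - t^2/R^2) + α * t^2 * u t * (-(2*t/R^2)))
        = w t + α * t^2 * (-v t) * (1 - ph D t) * (1 - t^2/R^2) + α * t^2 * u t * (2*t/R^2) := by
        rw [hw]; field_simp; ring
      rw [e]
      have b1 : 0 ≤ α * t^2 * (-v t) * (1 - ph D t) * (1 - t^2/R^2) := by
        have := sub_nonneg.2 hp
        have := neg_nonneg.2 hv
        positivity
      have b2 : 0 ≤ α * t^2 * u t * (2*t/R^2) := by positivity
      linarith)
  have hu := h.upos R ⟨hR.le, hR1.le⟩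
  have e : R^2/R^2 = 1 := div_self (by positivity)
  simp [e] at this
  have : 0 ≤ R * u R * (2 * R / R^2) := by positivity
  linarith

noncomputable def Vop (D : GelfandData) (α lam : ℝ) (g u : ℝ → ℝ) (s : ℝ) : ℝ :=
  lam * s / mu D α s * ∫ x in (0:ℝ)..1, x * mu D α (s * x) * ps D (s * x) * g (u (s * x))

lemma Vop_kernel_cont {g u : ℝ → ℝ} (gc : Continuous g) (uc : Continuous u) :
    Continuous (fun p : ℝ × ℝ => p.2 * mu D α (p.1 * p.2) * ps D (p.1 * p.2) * g (u (p.1 * p.2))) := by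
  have h1 := mu_cont D α
  have h2 := ps_cont D
  fun_prop

lemma Vop_cont {g u : ℝ → ℝ} (gc : Continuous g) (uc : Continuous u) :
    Continuous (Vop D α lam g u) := by
  have h1 := mu_cont D α
  unfold Vop
  refine Continuous.mul (Continuous.div (by fun_prop) h1 (fun x => (mu_pos D α x).ne')) ?_
  exact intervalIntegral.continuous_parametric_intervalIntegral_of_continuous' (μ := volume)
    (f := fun s x => x * mu D α (s * x) * ps D (s * x) * g (u (s * x)))
    (Vop_kernel_cont gc uc) 0 1

lemma Vop_kernel_cont' {g u : ℝ → ℝ} (gc : Continuous g) (uc : Continuous u) (s : ℝ) :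
    Continuous (fun x : ℝ => x * mu D α (s * x) * ps D (s * x) * g (u (s * x))) := by
  have h1 := mu_cont D α
  have h2 := ps_cont D
  fun_prop

lemma Vop_nonneg {g u : ℝ → ℝ} (hl : 0 < lam) (g0 : ∀ x, 0 ≤ g x) {s : ℝ} (hs : 0 ≤ s) :
    0 ≤ Vop D α lam g u s := by
  unfold Vop
  refine mul_nonneg (div_nonneg (by positivity) (mu_pos D α s).le) ?_
  apply intervalIntegral.integral_nonneg zero_le_one
  intro x hx
  have := hx.1
  have := mu_pos D α (s * x)
  have := ps_nonneg D (s*x)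
  have := g0 (u (s * x))
  positivity

lemma Vop_le {g u : ℝ → ℝ} {B : ℝ} (hα : 0 < α) (hl : 0 < lam) (gc : Continuous g) (uc : Continuous u)
    (g0 : ∀ x, 0 ≤ g x) (gB : ∀ x, g x ≤ B) {s : ℝ} (hs : 0 ≤ s) :
    Vop D α lam g u s ≤ lam * B * s / 2 := by
  have hm := mu_pos D α s
  have h1 : ∫ x in (0:ℝ)..1, x * mu D α (s * x) * ps D (s * x) * g (u (s * x)) ≤
      ∫ x in (0:ℝ)..1, x * (mu D α s * B) := by
    apply intervalIntegral.integral_mono_on zero_le_one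
      ((Vop_kernel_cont' gc uc s).intervalIntegrable _ _)
      (Continuous.intervalIntegrable (by fun_prop) _ _)
    intro x hx
    have h1 := hx.1
    have h2 := mu_pos D α (s * x)
    have h3 := ps_nonneg D (s*x)
    have h4 := g0 (u (s * x))
    have h5 : mu D α (s * x) ≤ mu D α s :=
      mu_mono D hα (mem_Ici.2 (by positivity)) hs (by nlinarith [hx.2])
    have h6 := ps_le D (s * x)
    have h7 : x * mu D α (s * x) * ps D (s * x) * g (u (s * x)) ≤ x * mu D α s * 1 * B := by
      have := gB (u (s * x))
      gcongr
    linarith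
  rw [intervalIntegral.integral_mul_const, integral_id] at h1
  have h2 : 0 ≤ lam * s / mu D α s := by positivity
  unfold Vop
  refine (mul_le_mul_of_nonneg_left h1 h2).trans (le_of_eq ?_)
  field_simp
  ring

lemma Vop_mono {g u w : ℝ → ℝ} (hl : 0 < lam) (gc : Continuous g) (uc : Continuous u)
    (wc : Continuous w) (gm : Monotone g)
    (huw : ∀ r ∈ Icc (0:ℝ) 1, u r ≤ w r) {s : ℝ} (hs : s ∈ Icc (0:ℝ) 1) :
    Vop D α lam g u s ≤ Vop D α lam g w s := by
  have hm := mu_pos D α s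
  have hs0 := hs.1
  unfold Vop
  refine mul_le_mul_of_nonneg_left ?_ (by positivity)
  apply intervalIntegral.integral_mono_on zero_le_one
      ((Vop_kernel_cont' gc uc s).intervalIntegrable _ _)
      ((Vop_kernel_cont' gc wc s).intervalIntegrable _ _)
  intro x hx
  have h1 := hx.1
  have h2 := mu_pos D α (s * x)
  have h3 := ps_nonneg D (s*x)
  have h4 : u (s * x) ≤ w (s * x) := huw _ ⟨by positivity, by nlinarith [hx.2, hs.2]⟩
  have h5 := gm h4
  gcongr

lemma Vop_congr {g u w : ℝ → ℝ} 
    (huw : ∀ r ∈ Icc (0:ℝ) 1, u r = w r) {s : ℝ} (hs : s ∈ Icc (0:ℝ) 1) :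
    Vop D α lam g u s = Vop D α lam g w s := by
  unfold Vop
  congr 1
  apply intervalIntegral.integral_congr
  intro x hx
  rw [uIcc_of_le zero_le_one] at hx
  have h1 := hx.1
  have hs0 := hs.1
  simp only
  rw [huw _ ⟨by positivity, by nlinarith [hx.2, hs.2]⟩]

lemma Vop_eq {g u : ℝ → ℝ} {s : ℝ} (hs : 0 ≤ s) :
    Vop D α lam g u s * (s * mu D α s) =
      lam * ∫ t in (0:ℝ)..s, t * mu D α t * ps D t * g (u t) := by
  have hm := mu_pos D α s
  rcases eq_or_lt_of_le hs with h | h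
  · simp [← h]
  have := intervalIntegral.mul_integral_comp_mul_left (a := 0) (b := 1)
    (f := fun t => t * mu D α t * ps D t * g (u t)) s
  simp only [mul_zero, mul_one] at this
  rw [← this]
  unfold Vop
  have e : ∫ x in (0:ℝ)..1, s * x * mu D α (s * x) * ps D (s * x) * g (u (s * x)) =
    s * ∫ x in (0:ℝ)..1, x * mu D α (s * x) * ps D (s * x) * g (u (s * x)) := by
    rw [← intervalIntegral.integral_const_mul]
    congr 1; ext x; ring
  rw [e]
  field_simp

noncomputable def Top' (D : GelfandData) (α lam : ℝ) (g u : ℝ → ℝ) (r : ℝ) : ℝ :=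
  ∫ s in r..1, Vop D α lam g u s

lemma Top_deriv {g u : ℝ → ℝ} (gc : Continuous g) (uc : Continuous u) (r : ℝ) :
    HasDerivAt (Top' D α lam g u) (-(Vop D α lam g u r)) r := by
  have hc := Vop_cont (D := D) (α := α) (lam := lam) gc uc
  exact intervalIntegral.integral_hasDerivAt_left (hc.intervalIntegrable _ _)
    (hc.stronglyMeasurableAtFilter _ _) hc.continuousAt

lemma Top_cont {g u : ℝ → ℝ} (gc : Continuous g) (uc : Continuous u) :
    Continuous (Top' D α lam g u) :=
  continuous_iff_continuousAt.2 fun r => (Top_deriv gc uc r).continuousAt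

noncomputable def iter (D : GelfandData) (α lam : ℝ) (g : ℝ → ℝ) : ℕ → ℝ → ℝ
  | 0 => fun _ => 0
  | n+1 => Top' D α lam g (iter D α lam g n)

lemma iter_cont {g : ℝ → ℝ} (gc : Continuous g) (n : ℕ) : Continuous (iter D α lam g n) := by
  induction n with
  | zero => exact continuous_const
  | succ n ih => exact Top_cont gc ih

lemma Top_lip {g u : ℝ → ℝ} {B : ℝ} (hα : 0 < α) (hl : 0 < lam) (gc : Continuous g) (uc : Continuous u)
    (g0 : ∀ x, 0 ≤ g x) (gB : ∀ x, g x ≤ B) {x y : ℝ} (hx : 0 ≤ x) (hxy : x ≤ y) (hy : y ≤ 1) :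
    Top' D α lam g u y ≤ Top' D α lam g u x ∧
    Top' D α lam g u x - Top' D α lam g u y ≤ lam * B / 2 * (y - x) := by
  have hB : 0 ≤ B := (g0 0).trans (gB 0)
  have hc := Top_cont (D := D) (α := α) (lam := lam) gc uc
  have h1 := le_of_deriv_le (k := fun _ => 0) (k' := fun _ => 0) hxy
    hc.continuousOn continuousOn_const
    (fun t ht => Top_deriv gc uc t)
    (fun x _ => hasDerivAt_const x 0)
    (fun t ht => by
      have := Vop_nonneg (D := D) (α := α) (u := u) hl g0 (hx.trans ht.1.le)
      linarith)
  have h2 := le_of_deriv_le (h := fun t => -(lam * B / 2) * t) (h' := fun t => -(lam * B / 2)) hxy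
    (by fun_prop)
    hc.continuousOn 
    (fun x _ => by simpa using (hasDerivAt_id x).const_mul (-(lam * B/2)))
    (fun t ht => Top_deriv gc uc t)
    (fun t ht => by
      have ht0 : 0 ≤ t := hx.trans ht.1.le
      have := Vop_le (D := D) hα hl gc uc g0 gB ht0
      have h3 : lam * B * t ≤ lam * B * 1 := by
        have : t ≤ 1 := ht.2.le.trans hy
        gcongr
      linarith)
  constructor <;> linarith

lemma exists_trunc (D : GelfandData) {α lam B : ℝ} {g : ℝ → ℝ} (hα : 0 < α) (hl : 0 < lam)
    (gc : Continuous g) (gm : Monotone g) (g0 : ∀ x, 0 ≤ g x) (gB : ∀ x, g x ≤ B) :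
    ∃ u V : ℝ → ℝ, Continuous V ∧ (∀ r, HasDerivAt u (-V r) r) ∧ u 1 = 0 ∧
      (∀ s ∈ Icc (0:ℝ) 1, 0 ≤ V s) ∧ (∀ s ∈ Icc (0:ℝ) 1, V s ≤ lam * B * s / 2) ∧
      ∀ s ∈ Icc (0:ℝ) 1, V s * (s * mu D α s) =
        lam * ∫ t in (0:ℝ)..s, t * mu D α t * ps D t * g (u t) := by
  set w := iter D α lam g with hw
  have hB : 0 ≤ B := (g0 0).trans (gB 0)
  have wc : ∀ n, Continuous (w n) := iter_cont gc
  have wsucc : ∀ n, w (n+1) = Top' D α lam g (w n) := fun n => rfl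
  have wlip : ∀ n x y, 0 ≤ x → x ≤ y → y ≤ 1 → w n y ≤ w n x ∧ w n x - w n y ≤ lam * B/2 * (y - x) := by
    intro n x y hx hxy hy
    cases n with
    | zero =>
      have : 0 ≤ lam * B / 2 * (y - x) := mul_nonneg (by positivity) (by linarith)
      simpa [hw, iter] using this
    | succ n => exact Top_lip hα hl gc (wc n) g0 gB hx hxy hy
  have w1 : ∀ n, w n 1 = 0 := by
    intro n
    cases n with
    | zero => simp [hw, iter]
    | succ n => simp [wsucc, Top']
  have wmono : ∀ n, ∀ r ∈ Icc (0:ℝ) 1, w n r ≤ w (n+1) r := by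
    intro n
    induction n with
    | zero =>
      intro r hr
      have := (wlip 1 r 1 hr.1 hr.2 le_rfl).1
      rw [w1] at this
      simpa [hw, iter] using this
    | succ n ih =>
      intro r hr
      rw [wsucc, wsucc (n+1)]
      apply intervalIntegral.integral_mono_on hr.2
        ((Vop_cont gc (wc n)).intervalIntegrable _ _)
        ((Vop_cont gc (wc (n+1))).intervalIntegrable _ _)
      intro s hs
      exact Vop_mono hl gc (wc n) (wc (n+1)) gm ih ⟨hr.1.trans hs.1, hs.2⟩
  have wbd : ∀ n, ∀ r ∈ Icc (0:ℝ) 1, w n r ≤ lam * B / 2 := by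
    intro n r hr
    have := (wlip n r 1 hr.1 hr.2 le_rfl).2
    rw [w1] at this
    have h2 : lam * B / 2 * (1 - r) ≤ lam * B / 2 * 1 := by
      have := hr.1
      gcongr; linarith
    linarith
  set U : ℝ → ℝ := fun r => ⨆ n, w n (cl r) with hU
  have hlim : ∀ r, Tendsto (fun n => w n (cl r)) atTop (nhds (U r)) := by
    intro r
    apply tendsto_atTop_ciSup
    · exact monotone_nat_of_le_succ (fun n => wmono n _ (cl_mem r))
    · exact ⟨lam * B / 2, by rintro _ ⟨n, rfl⟩; exact wbd n _ (cl_mem r)⟩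
  have hlim' : ∀ r ∈ Icc (0:ℝ) 1, Tendsto (fun n => w n r) atTop (nhds (U r)) := by
    intro r hr
    have := hlim r
    rwa [cl_eq hr] at this
  have hUlip : ∀ x y, |U x - U y| ≤ lam * B / 2 * |cl x - cl y| := by
    intro x y
    refine le_of_tendsto ((hlim x).sub (hlim y)).abs (Eventually.of_forall fun n => ?_)
    rcases le_total (cl x) (cl y) with h | h
    · have := wlip n _ _ (cl_mem x).1 h (cl_mem y).2
      rw [abs_of_nonneg (by linarith), abs_of_nonpos (by linarith)]
      linarith
    · have := wlip n _ _ (cl_mem y).1 h (cl_mem x).2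
      rw [abs_of_nonpos (by linarith), abs_of_nonneg (by linarith)]
      linarith
  have Uc : Continuous U := by
    rw [continuous_iff_continuousAt]
    intro x
    have h1 : Tendsto (fun y => lam * B / 2 * |cl y - cl x|) (nhds x) (nhds 0) := by
      have hc := cl_cont
      have : Continuous (fun y => lam * B / 2 * |cl y - cl x|) := by fun_prop
      have := this.tendsto x
      simpa using this
    rw [ContinuousAt, tendsto_iff_dist_tendsto_zero]
    exact squeeze_zero (fun _ => dist_nonneg) (fun y => by rw [Real.dist_eq]; exact hUlip y x) h1
  have hV : ∀ s ∈ Icc (0:ℝ) 1, Tendsto (fun n => Vop D α lam g (w n) s) atTop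
      (nhds (Vop D α lam g U s)) := by
    intro s hs
    unfold Vop
    apply Tendsto.const_mul
    have hmc := mu_cont D α
    apply intervalIntegral.tendsto_integral_filter_of_dominated_convergence
      (fun x => |x * mu D α (s * x) * ps D (s * x)| * B)
    · exact Eventually.of_forall fun n => (Vop_kernel_cont' gc (wc n) s).aestronglyMeasurable
    · refine Eventually.of_forall fun n => Eventually.of_forall fun x _ => ?_
      rw [Real.norm_eq_abs, abs_mul, abs_of_nonneg (g0 _)]
      have := gB (w n (s * x))
      gcongr
    · have := ps_cont D
      exact Continuous.intervalIntegrable (by fun_prop) _ _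
    · refine Eventually.of_forall fun x hx => ?_
      rw [uIoc_of_le zero_le_one] at hx
      apply Tendsto.const_mul
      refine (gc.tendsto _).comp (hlim' _ ⟨?_, ?_⟩)
      · exact mul_nonneg hs.1 hx.1.le
      · nlinarith [hx.1, hx.2, hs.1, hs.2]
  have hfix : ∀ r ∈ Icc (0:ℝ) 1, U r = Top' D α lam g U r := by
    intro r hr
    have h1 : Tendsto (fun n => w (n+1) r) atTop (nhds (U r)) :=
      (hlim' r hr).comp (tendsto_add_atTop_nat 1)
    refine tendsto_nhds_unique h1 ?_
    simp only [wsucc]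
    unfold Top'
    apply intervalIntegral.tendsto_integral_filter_of_dominated_convergence (fun _ => lam * B / 2)
    · exact Eventually.of_forall fun n => (Vop_cont gc (wc n)).aestronglyMeasurable
    · refine Eventually.of_forall fun n => Eventually.of_forall fun x hx => ?_
      rw [uIoc_of_le hr.2] at hx
      have hx0 : 0 ≤ x := hr.1.trans hx.1.le
      rw [Real.norm_eq_abs, abs_of_nonneg (Vop_nonneg hl g0 hx0)]
      have := Vop_le (D := D) hα hl gc (wc n) g0 gB hx0
      have h3 : lam * B * x ≤ lam * B * 1 := by
        have := hx.2
        gcongr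
      linarith
    · exact intervalIntegrable_const
    · refine Eventually.of_forall fun x hx => ?_
      rw [uIoc_of_le hr.2] at hx
      exact hV x ⟨hr.1.trans hx.1.le, hx.2⟩
  refine ⟨Top' D α lam g U, Vop D α lam g U, Vop_cont gc Uc, Top_deriv gc Uc, by simp [Top'],
    fun s hs => Vop_nonneg hl g0 hs.1, fun s hs => Vop_le hα hl gc Uc g0 gB hs.1, ?_⟩
  intro s hs
  rw [Vop_congr hfix hs, Vop_eq hs.1]

structure Tr (D : GelfandData) (α lam : ℝ) (g u V : ℝ → ℝ) : Prop where
  Vc : Continuous V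
  ud : ∀ r, HasDerivAt u (-V r) r
  u1 : u 1 = 0
  V0 : ∀ s ∈ Icc (0:ℝ) 1, 0 ≤ V s
  eq : ∀ s ∈ Icc (0:ℝ) 1, V s * (s * mu D α s) =
        lam * ∫ t in (0:ℝ)..s, t * mu D α t * ps D t * g (u t)

variable {g V : ℝ → ℝ}

lemma Tr.uc (h : Tr D α lam g u V) : Continuous u :=
  continuous_iff_continuousAt.2 fun r => (h.ud r).continuousAt

lemma Tr.anti (h : Tr D α lam g u V) {x y : ℝ} (hx : 0 ≤ x) (hxy : x ≤ y) (hy : y ≤ 1) : u y ≤ u x := by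
  have h1 := le_of_deriv_le (k := fun _ => 0) (k' := fun _ => 0) hxy
    h.uc.continuousOn continuousOn_const
    (fun t ht => h.ud t)
    (fun x _ => hasDerivAt_const x 0)
    (fun t ht => by
      have := h.V0 t ⟨hx.trans ht.1.le, ht.2.le.trans hy⟩
      linarith)
  linarith

lemma Tr.nonneg (h : Tr D α lam g u V) {x : ℝ} (hx : x ∈ Icc (0:ℝ) 1) : 0 ≤ u x := by
  rw [← h.u1]; exact h.anti hx.1 hx.2 le_rfl

lemma Tr.kc (h : Tr D α lam g u V) (gc : Continuous g) :
    Continuous (fun t => t * mu D α t * ps D t * g (u t)) := by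
  have h1 := mu_cont D α
  have h2 := ps_cont D
  have h3 := h.uc
  fun_prop

lemma Tr.Id (h : Tr D α lam g u V) (gc : Continuous g) (s : ℝ) :
    HasDerivAt (fun s => ∫ t in (0:ℝ)..s, t * mu D α t * ps D t * g (u t))
      (s * mu D α s * ps D s * g (u s)) s := by
  have hc := h.kc gc
  exact intervalIntegral.integral_hasDerivAt_right (hc.intervalIntegrable 0 s)
    (hc.stronglyMeasurableAtFilter _ _) hc.continuousAt

lemma Tr.Ic (h : Tr D α lam g u V) (gc : Continuous g) :
    Continuous (fun s => ∫ t in (0:ℝ)..s, t * mu D α t * ps D t * g (u t)) :=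
  continuous_iff_continuousAt.2 fun r => (h.Id gc r).continuousAt

lemma Tr.isSol (h : Tr D α lam g u V) (hl : 0 < lam) (gc : Continuous g)
    (gpos : ∀ x, 0 < g x) (hg : ∀ r ∈ Icc (0:ℝ) 1, g (u r) = ff D (u r)) :
    IsSolution D α lam u := by
  have hI := h.kc gc
  set I : ℝ → ℝ := fun s => ∫ t in (0:ℝ)..s, t * mu D α t * ps D t * g (u t) with hIdef
  have hVeq : ∀ s ∈ Ioo (0:ℝ) 1, V s = lam * I s / (s * mu D α s) := by
    intro s hs
    have := mu_pos D α s
    have hs0 := hs.1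
    rw [eq_div_iff (by positivity)]
    exact h.eq s ⟨hs.1.le, hs.2.le⟩
  have hV0 : V 0 = 0 := by
    -- V s * mu s = lam * I s / s, use derivative of I at 0
    have hd := (h.Id gc 0)
    have hd' : HasDerivAt I 0 0 := by simpa using hd
    have h1 := hd'.hasDerivWithinAt (s := Ioi 0)
    rw [hasDerivWithinAt_iff_tendsto_slope' (by simp)] at h1
    have h2 : Tendsto (fun s => V s * mu D α s) (nhdsWithin (0:ℝ) (Ioi 0)) (nhds (V 0 * mu D α 0)) :=
      ((h.Vc.mul (mu_cont D α)).tendsto 0).mono_left nhdsWithin_le_nhds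
    have h3 : Tendsto (fun s => lam * slope I 0 s) (nhdsWithin (0:ℝ) (Ioi 0)) (nhds (lam * 0)) :=
      h1.const_mul lam
    have h4 : (fun s => V s * mu D α s) =ᶠ[nhdsWithin (0:ℝ) (Ioi 0)] (fun s => lam * slope I 0 s) := by
      filter_upwards [Ioo_mem_nhdsGT (zero_lt_one (α := ℝ))] with s hs
      have hs0 := hs.1
      have hm := mu_pos D α s
      rw [hVeq s hs, slope_def_field]
      have : I 0 = 0 := by simp [hIdef]
      rw [this]
      field_simp
      ring
    have h5 := tendsto_nhds_unique (h2.congr' h4) h3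
    rw [mu_zero] at h5
    linarith
  have hVd : ∀ r ∈ Ioo (0:ℝ) 1, HasDerivAt V
      (lam * ps D r * g (u r) - (1/r + α * r * ph D r) * V r) r := by
    intro r hr
    have hr0 := hr.1.ne'
    have hm := (mu_pos D α r).ne'
    have h1 := ((h.Id gc r).const_mul lam).div ((hasDerivAt_id r).mul (mu_deriv D α r))
      (mul_ne_zero hr0 hm)
    have h2 : V =ᶠ[nhds r] (fun s => lam * I s / (s * mu D α s)) := by
      filter_upwards [Ioo_mem_nhds hr.1 hr.2] with s hs using hVeq s hs
    refine (HasDerivAt.congr_of_eventuallyEq h1 h2).congr_deriv ?_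
    rw [hVeq r hr]
    simp only [hIdef, id, Pi.mul_apply, one_mul]
    generalize ∫ t in (0:ℝ)..r, t * mu D α t * ps D t * g (u t) = J
    field_simp
  have hdu : deriv u = fun r => - V r := funext fun r => (h.ud r).deriv
  have hdw : ∀ r ∈ Icc (0:ℝ) 1, derivWithin u (Icc 0 1) r = - V r := fun r hr =>
    (h.ud r).hasDerivWithinAt.derivWithin (uniqueDiffOn_Icc zero_lt_one r hr)
  have hC1 : ContDiff ℝ 1 u := by
    rw [contDiff_one_iff_deriv]
    refine ⟨fun r => (h.ud r).differentiableAt, ?_⟩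
    rw [hdu]; exact h.Vc.neg
  have hVpos : ∀ s ∈ Ioo (0:ℝ) 1, 0 < V s := by
    intro s hs
    rw [hVeq s hs]
    have hs0 := hs.1
    have hm := mu_pos D α s
    have : 0 < I s := by
      obtain ⟨r0, hr0, hr⟩ := exists_r0 D (by norm_num : (0:ℝ) < 1/2)
      apply intervalIntegral.integral_pos hs0 hI.continuousOn
      · intro t ht
        have := ht.1.le
        have := mu_pos D α t
        have := ps_nonneg D t
        have := gpos (u t)
        positivity
      · refine ⟨min s r0, ⟨le_min hs0.le hr0.1.le, min_le_left _ _⟩, ?_⟩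
        have h1 : 0 < min s r0 := lt_min hs0 hr0.1
        have := mu_pos D α (min s r0)
        have h2 : 0 < ps D (min s r0) := by linarith [(hr _ (min_le_right s r0)).2]
        have := gpos (u (min s r0))
        positivity
    positivity
  refine ⟨hC1.contDiffOn, ?_, ?_, ?_, h.u1, ?_⟩
  · have : ContDiffOn ℝ (1+1) u (Ioo 0 1) := by
      rw [contDiffOn_succ_iff_deriv_of_isOpen isOpen_Ioo]
      refine ⟨fun r _ => (h.ud r).differentiableAt.differentiableWithinAt, by simp, ?_⟩
      have hc : ContDiffOn ℝ (0+1) (deriv u) (Ioo 0 1) := by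
        rw [contDiffOn_succ_iff_deriv_of_isOpen isOpen_Ioo]
        refine ⟨?_, by simp, ?_⟩
        · rw [hdu]
          exact fun r hr => (hVd r hr).neg.differentiableAt.differentiableWithinAt
        · rw [contDiffOn_zero, hdu]
          have hcc : ContinuousOn (fun r => -(lam * ps D r * g (u r) - (1/r + α * r * ph D r) * V r)) (Ioo 0 1) := by
            have h1 := ps_cont D
            have h2 := ph_cont D
            have h3 := h.uc
            have h4 := h.Vc
            have h5 : ContinuousOn (fun r:ℝ => 1/r) (Ioo 0 1) :=
              continuousOn_const.div continuousOn_id (fun x hx => hx.1.ne')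
            have h6 : Continuous (fun r => lam * ps D r * g (u r)) := by fun_prop
            have h7 : Continuous (fun r => α * r * ph D r) := by fun_prop
            exact (h6.continuousOn.sub ((h5.add h7.continuousOn).mul h4.continuousOn)).neg
          refine hcc.congr ?_
          intro r hr
          exact (hVd r hr).neg.deriv
      simpa using hc
    norm_num at this
    exact this
  · have hs : StrictAntiOn u (Icc 0 1) := by
      apply strictAntiOn_of_deriv_neg (convex_Icc 0 1) h.uc.continuousOn
      intro x hx
      rw [interior_Icc] at hx
      rw [hdu]
      linarith [hVpos x hx]
    intro r hr
    rw [← h.u1]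
    exact hs ⟨hr.1, hr.2.le⟩ (by simp) hr.2
  · rw [hdw 0 (by simp), hV0, neg_zero]
  · intro r hr
    have hr' : r ∈ Icc (0:ℝ) 1 := ⟨hr.1.le, hr.2.le⟩
    have h1 : derivWithin (derivWithin u (Icc 0 1)) (Ioo 0 1) r =
        -(lam * ps D r * g (u r) - (1/r + α * r * ph D r) * V r) := by
      rw [derivWithin_congr (fun x hx => hdw x ⟨hx.1.le, hx.2.le⟩) (hdw r hr'),
        derivWithin_of_mem_nhds (Ioo_mem_nhds hr.1 hr.2)]
      exact (hVd r hr).neg.deriv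
    rw [h1, hdw r hr', hg r hr', ph_eq D hr', ps_eq D hr', ff_eq D (h.nonneg hr')]
    ring

lemma Tr.outer (h : Tr D α lam g u V) (hα : 0 < α) (hl : 0 < lam) (gc : Continuous g)
    (g0 : ∀ x, 0 ≤ g x) {B r0 : ℝ} (gB : ∀ x, g x ≤ B) (hr0 : r0 ∈ Ioo (0:ℝ) 1) :
    u r0 ≤ lam / α * (B / r0 * ∫ s in r0..1, D.M s) := by
  have hB : 0 ≤ B := (g0 0).trans (gB 0)
  have hr00 := hr0.1
  have hV : ∀ s ∈ Ioo r0 1, V s ≤ lam / α * (B / r0) * D.M s := by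
    intro s hs
    have hs0 : 0 < s := hr0.1.trans hs.1
    have hM : ∀ x ∈ Icc 0 s, ps D x ≤ D.M s * ph D x := by
      intro x hx
      have hx1 : x < 1 := hx.2.trans_lt hs.2
      have := (D.M_def s ⟨hs0.le, hs.2⟩).2 ⟨x, hx, rfl⟩
      simp only at this
      rw [div_le_iff₀ (D.phi_pos x ⟨hx.1, hx1⟩)] at this
      rwa [ps_eq D ⟨hx.1, hx1.le⟩, ph_eq D ⟨hx.1, hx1.le⟩]
    have hM0 : 0 ≤ D.M s := by
      have := hM 0 ⟨le_rfl, hs0.le⟩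
      rw [ps_eq D (by simp), ph_eq D (by simp), D.phi_zero, D.psi_zero] at this
      linarith
    have hmc := mu_cont D α
    have key := le_of_deriv_le (k := fun x => B * D.M s * ((mu D α x - 1) / α))
      (k' := fun x => B * D.M s * ((α * x * ph D x * mu D α x) / α)) hs0.le
      (h.Ic gc).continuousOn (by fun_prop) (fun x _ => h.Id gc x)
      (fun x _ => (((mu_deriv D α x).sub_const 1).div_const α).const_mul _)
      (fun x hx => by
        have e : B * D.M s * ((α * x * ph D x * mu D α x) / α) =
          x * mu D α x * (D.M s * ph D x) * B := by field_simp
        rw [e]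
        have h1 := hM x ⟨hx.1.le, hx.2.le⟩
        have h2 := gB (u x)
        have h3 := g0 (u x)
        have h4 := hx.1.le
        have h5 := mu_pos D α x
        have h6 := ps_nonneg D x
        have h7 := ph_nonneg D x
        gcongr)
    simp [mu_zero] at key
    have hm := mu_pos D α s
    have e := h.eq s ⟨hs0.le, hs.2.le⟩
    have h7 : V s * (s * mu D α s) ≤ lam * (B * D.M s * (mu D α s / α)) := by
      rw [e]
      apply mul_le_mul_of_nonneg_left _ hl.le
      refine key.trans ?_
      gcongr
      linarith
    have h8 : V s ≤ lam / α * B * D.M s / s := by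
      rw [le_div_iff₀ hs0]
      have : V s * s * mu D α s ≤ lam / α * B * D.M s * mu D α s := by
        calc _ = V s * (s * mu D α s) := by ring
          _ ≤ _ := h7
          _ = _ := by ring
      exact le_of_mul_le_mul_right this hm
    refine h8.trans ?_
    have e2 : lam / α * (B / r0) * D.M s = lam / α * B * D.M s / r0 := by ring
    rw [e2]
    have := hs.1.le
    gcongr
  have hMi : IntervalIntegrable D.M volume r0 1 := by
    rw [intervalIntegrable_iff_integrableOn_Ioo_of_le hr0.2.le]
    exact D.M_int.mono_set (Ioo_subset_Ioo_left hr0.1.le)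
  have h1 : ∫ s in r0..1, -V s = u 1 - u r0 :=
    intervalIntegral.integral_eq_sub_of_hasDerivAt (fun x _ => h.ud x)
      (h.Vc.neg.intervalIntegrable _ _)
  rw [h.u1, intervalIntegral.integral_neg] at h1
  have h2 : ∫ s in r0..1, V s ≤ ∫ s in r0..1, lam / α * (B / r0) * D.M s := by
    apply intervalIntegral.integral_mono_on_of_le_Ioo hr0.2.le (h.Vc.intervalIntegrable _ _)
      (hMi.const_mul _) hV
  rw [intervalIntegral.integral_const_mul] at h2
  linarith

lemma Tr.middle (h : Tr D α lam g u V) (hα : 0 < α) (hl : 0 < lam) (gc : Continuous g)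
    (g0 : ∀ x, 0 ≤ g x) {B L η r0 s : ℝ} (gB : ∀ x, g x ≤ B) (hr0 : r0 ∈ Ioo (0:ℝ) 1)
    (hL : 0 ≤ L) (gL : ∀ x y, x ≤ y → g y - g x ≤ L * (y - x))
    (hVB : ∀ s ∈ Icc (0:ℝ) 1, V s ≤ lam * B * s / 2)
    (hη : η ≤ 1/2) (hph : ∀ r ≤ r0, 1 - η ≤ ph D r) (hs : 0 < s) (hsr : s ≤ r0) :
    V s ≤ lam / α / (1 - η) * (g (u s) + L * B * (lam / α)) / s := by
  have hB : 0 ≤ B := (g0 0).trans (gB 0)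
  have hr1 := hr0.2
  have hη' : 0 < 1 - η := by linarith
  have hu : ∀ t ∈ Icc 0 s, u t - u s ≤ lam * B / 4 * (s^2 - t^2) := by
    intro t ht
    have := le_of_deriv_le (h := fun x => - u x) (h' := fun x => - -V x)
      (k := fun x => lam * B / 4 * x^2) (k' := fun x => lam * B / 4 * (2 * x)) ht.2
      h.uc.neg.continuousOn (by fun_prop) (fun x _ => (h.ud x).neg)
      (fun x _ => by
        have := ((hasDerivAt_id x).pow 2).const_mul (lam * B / 4)
        exact HasDerivAt.congr_deriv this (by simp))
      (fun x hx => by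
        have := hVB x ⟨ht.1.trans hx.1.le, by linarith [hx.2]⟩
        linarith)
    linarith
  set c := L * (lam * B / 4) with hc
  have hc0 : 0 ≤ c := by positivity
  have hmc := mu_cont D α
  have key := le_of_deriv_le
    (h := fun x => (1 - η) * ∫ t in (0:ℝ)..x, t * mu D α t * ps D t * g (u t))
    (h' := fun x => (1 - η) * (x * mu D α x * ps D x * g (u x)))
    (k := fun x => (mu D α x - 1) / α * (g (u s) + c * (s^2 - x^2)) + 4 * c / α^2 * (mu D α x - 1))
    (k' := fun x => (α * x * ph D x * mu D α x) / α * (g (u s) + c * (s^2 - x^2)) +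
      (mu D α x - 1) / α * (c * (-(2 * x))) + 4 * c / α^2 * (α * x * ph D x * mu D α x)) hs.le
    ((h.Ic gc).const_smul (1-η)).continuousOn
    (by fun_prop)
    (fun x _ => (h.Id gc x).const_mul _)
    (fun x _ => by
      have a1 := ((mu_deriv D α x).sub_const 1)
      have a2 : HasDerivAt (fun x => g (u s) + c * (s^2 - x^2)) (c * (-(2 * x))) x := by
        have := ((((hasDerivAt_id x).pow 2).const_sub (s^2)).const_mul c).const_add (g (u s))
        exact HasDerivAt.congr_deriv this (by simp)
      exact ((a1.div_const α).mul a2).add (a1.const_mul _))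
    (fun x hx => by
      have hx0 := hx.1
      have hm := mu_pos D α x
      have h1 := hph x (by linarith [hx.2])
      have h2 := ps_le D x
      have h3 := ps_nonneg D x
      have h4 : g (u x) ≤ g (u s) + c * (s^2 - x^2) := by
        have h5 := gL _ _ (h.anti hx0.le hx.2.le (by linarith))
        have h6 := mul_le_mul_of_nonneg_left (hu x ⟨hx0.le, hx.2.le⟩) hL
        rw [hc]; linarith
      have h7 := g0 (u x)
      have e1 : (1 - η) * (x * mu D α x * ps D x * g (u x)) ≤
          x * mu D α x * ph D x * (g (u s) + c * (s^2 - x^2)) := by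
        have : (1 - η) * (x * mu D α x * ps D x * g (u x)) =
          x * mu D α x * ((1 - η) * ps D x) * g (u x) := by ring
        rw [this]
        have h8 : (1 - η) * ps D x ≤ ph D x := by nlinarith
        have h9 := ph_nonneg D x
        gcongr
      have e2 : (α * x * ph D x * mu D α x) / α * (g (u s) + c * (s^2 - x^2)) +
          (mu D α x - 1) / α * (c * (-(2 * x))) + 4 * c / α^2 * (α * x * ph D x * mu D α x) =
          x * mu D α x * ph D x * (g (u s) + c * (s^2 - x^2)) +
          (2 * c * x / α) * ((2 * ph D x - 1) * mu D α x + 1) := by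
        field_simp; ring
      rw [e2]
      have h10 : 0 ≤ (2 * ph D x - 1) * mu D α x + 1 := by
        have : 0 ≤ 2 * ph D x - 1 := by linarith
        positivity
      have : 0 ≤ (2 * c * x / α) * ((2 * ph D x - 1) * mu D α x + 1) := by positivity
      linarith)
  simp [mu_zero] at key
  have hm := mu_pos D α s
  have e := h.eq s ⟨hs.le, by linarith⟩
  rw [le_div_iff₀ hs]
  have hgs := g0 (u s)
  have h1 : (1 - η) * (V s * s * mu D α s) ≤ lam * ((mu D α s) / α * (g (u s) + 4 * c / α)) := by
    have : (1 - η) * (V s * s * mu D α s) = lam * ((1 - η) * ∫ t in (0:ℝ)..s, t * mu D α t * ps D t * g (u t)) := by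
      rw [mul_left_comm lam, ← e]; ring
    rw [this]
    apply mul_le_mul_of_nonneg_left _ hl.le
    refine key.trans ?_
    have e3 : (mu D α s - 1) / α * g (u s) + 4 * c / α^2 * (mu D α s - 1) =
      (mu D α s - 1) / α * (g (u s) + 4 * c / α) := by field_simp
    rw [e3]
    gcongr
    linarith
  have e4 : lam / α / (1 - η) * (g (u s) + L * B * (lam / α)) =
      lam * ((mu D α s) / α * (g (u s) + 4 * c / α)) / ((1 - η) * mu D α s) := by
    rw [hc]; field_simp
  rw [e4, le_div_iff₀ (by positivity)]
  linarith

lemma Tr.total (h : Tr D α lam g u V) (hα : 0 < α) (hl : 0 < lam) (gc : Continuous g)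
    {B L η r0 c0 : ℝ} {G : ℝ → ℝ} (hc0 : 0 < c0) (gc0 : ∀ x, c0 ≤ g x)
    (gB : ∀ x, g x ≤ B) (hr0 : r0 ∈ Ioo (0:ℝ) 1)
    (hL : 0 ≤ L) (gL : ∀ x y, x ≤ y → g y - g x ≤ L * (y - x))
    (hVB : ∀ s ∈ Icc (0:ℝ) 1, V s ≤ lam * B * s / 2)
    (hη : η ≤ 1/2) (hph : ∀ r ≤ r0, 1 - η ≤ ph D r)
    (hG : ∀ x, HasDerivAt G (1 / g x) x) (hG0 : G 0 = 0) (hαr : 1 / Real.sqrt α ≤ r0) :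
    G (u 0) ≤ lam / α * (B / (4 * c0)) +
      lam / α / (1 - η) * (1 + L * B * (lam / α) / c0) * (Real.log α / 2) +
      lam / α * (B / r0 * ∫ s in r0..1, D.M s) / c0 := by
  have g0 : ∀ x, 0 ≤ g x := fun x => hc0.le.trans (gc0 x)
  have hB : 0 ≤ B := (g0 0).trans (gB 0)
  have Gc : Continuous G := continuous_iff_continuousAt.2 fun r => (hG r).continuousAt
  have gp : ∀ x, 0 < g x := fun x => hc0.trans_le (gc0 x)
  have Guc : Continuous (fun x => - G (u x)) := (Gc.comp h.uc).neg
  have Gud : ∀ x, HasDerivAt (fun x => - G (u x)) (V x / g (u x)) x := fun x =>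
    (((hG (u x)).comp x (h.ud x)).neg).congr_deriv (by ring)
  have hη' : 0 < 1 - η := by linarith
  have hsq : 0 < Real.sqrt α := Real.sqrt_pos.2 hα
  set a := 1 / Real.sqrt α with ha
  have ha0 : 0 < a := by positivity
  have ha2 : a^2 = 1/α := by rw [ha, div_pow, Real.sq_sqrt hα.le]; simp
  have hr1 := hr0.2
  -- inner
  have i1 := le_of_deriv_le (k := fun x => lam * B / (4 * c0) * x^2)
    (k' := fun x => lam * B / (4 * c0) * (2 * x)) ha0.le
    Guc.continuousOn (by fun_prop) (fun x _ => Gud x)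
    (fun x _ => by
      have := ((hasDerivAt_id x).pow 2).const_mul (lam * B / (4 * c0))
      exact HasDerivAt.congr_deriv this (by simp))
    (fun x hx => by
      have h1 := hVB x ⟨hx.1.le, by linarith [hx.2]⟩
      have hx0 := hx.1
      calc V x / g (u x) ≤ (lam * B * x / 2) / c0 := by
            have := gc0 (u x)
            gcongr
        _ = _ := by field_simp; ring)
  -- middle
  set κ := lam / α / (1 - η) * (1 + L * B * (lam / α) / c0) with hκ
  have hκ0 : 0 ≤ κ := by positivity
  have i2 := le_of_deriv_le (k := fun x => κ * Real.log x)
    (k' := fun x => κ * x⁻¹) hαr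
    Guc.continuousOn (by
      apply ContinuousOn.mul continuousOn_const
      apply Real.continuousOn_log.mono
      intro t ht; have : 0 < t := lt_of_lt_of_le ha0 ht.1
      simpa using this.ne') (fun x _ => Gud x)
    (fun x hx => by
      have : 0 < x := ha0.trans hx.1
      exact (Real.hasDerivAt_log this.ne').const_mul _)
    (fun x hx => by
      have hx0 : 0 < x := ha0.trans hx.1
      have h1 := h.middle hα hl gc g0 gB hr0 hL gL hVB hη hph hx0 hx.2.le
      have hgx := gp (u x)
      rw [div_le_iff₀ hgx]
      refine h1.trans ?_
      have h2 : g (u x) + L * B * (lam / α) ≤ (1 + L * B * (lam / α) / c0) * g (u x) := by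
        have : L * B * (lam / α) ≤ L * B * (lam / α) / c0 * g (u x) := by
          rw [div_mul_eq_mul_div, le_div_iff₀ hc0]
          have := gc0 (u x)
          gcongr
        linarith
      calc lam / α / (1 - η) * (g (u x) + L * B * (lam / α)) / x 
          ≤ lam / α / (1 - η) * ((1 + L * B * (lam / α) / c0) * g (u x)) / x := by gcongr
        _ = κ * x⁻¹ * g (u x) := by rw [hκ]; ring)
  -- outer
  have i3 : G (u r0) ≤ u r0 / c0 := by
    have hur : 0 ≤ u r0 := h.nonneg ⟨hr0.1.le, hr1.le⟩
    have := le_of_deriv_le (k := fun x => x / c0) (k' := fun x => 1 / c0) hur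
      Gc.continuousOn (by fun_prop) (fun x _ => hG x)
      (fun x _ => (hasDerivAt_id x).div_const _)
      (fun x _ => one_div_le_one_div_of_le hc0 (gc0 x))
    simp [hG0] at this
    exact this
  have i4 := h.outer hα hl gc g0 gB hr0
  have i5 : u r0 / c0 ≤ lam / α * (B / r0 * ∫ s in r0..1, D.M s) / c0 := by gcongr
  have hlog : κ * Real.log r0 - κ * Real.log a ≤ κ * (Real.log α / 2) := by
    have h1 : Real.log r0 ≤ 0 := Real.log_nonpos hr0.1.le hr1.le
    have h2 : Real.log a = - (Real.log α / 2) := by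
      rw [ha, one_div, Real.log_inv, Real.log_sqrt hα.le]
    rw [h2]
    nlinarith
  have e1 : lam * B / (4 * c0) * a^2 = lam / α * (B / (4 * c0)) := by rw [ha2]; ring
  rw [e1] at i1
  simp at i1
  linarith

lemma slope_bound (D : GelfandData) {m p q : ℝ} (hm : 0 ≤ m) (hp : 0 ≤ p) (hpq : p ≤ q) (hq : q ≤ m) :
    ff D q - ff D p ≤ (ff D (m+1) - ff D m) * (q - p) := by
  have hc := ff_convex D
  rcases eq_or_lt_of_le hpq with h | h
  · simp [h]
  have main : (ff D q - ff D p) / (q - p) ≤ ff D (m+1) - ff D m := by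
    have e : ff D (m+1) - ff D m = (ff D (m+1) - ff D m) / (m + 1 - m) := by simp
    rcases eq_or_lt_of_le hq with h2 | h2
    · rw [e, h2]
      exact hc.slope_mono_adjacent hp (show (0:ℝ) ≤ m+1 by linarith) (h2 ▸ h) (by linarith)
    · refine (hc.slope_mono_adjacent hp (show (0:ℝ) ≤ m from hm) h h2).trans ?_
      rw [e]
      exact hc.slope_mono_adjacent (show (0:ℝ) ≤ q by linarith) (show (0:ℝ) ≤ m+1 by linarith) h2 (by linarith)
  rwa [div_le_iff₀ (by linarith)] at main

lemma exists_sol (D : GelfandData) {ε : ℝ} (h0 : 0 < ε) (h1 : ε < 1) :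
    ∀ᶠ α in atTop, 2 * D.K * (1 - ε) * α / Real.log α ∈ solvableSet D α := by
  have hK := K_pos D
  have hm : ∃ m, 0 ≤ m ∧ (1 - ε/2) * D.K < FF D m := by
    have := (FF_tendsto D).eventually (lt_mem_nhds (show (1 - ε/2) * D.K < D.K by nlinarith))
    obtain ⟨m, h⟩ := (this.and (eventually_ge_atTop 0)).exists
    exact ⟨m, h.2, h.1⟩
  obtain ⟨m, hm0, hm⟩ := hm
  set g : ℝ → ℝ := fun x => ff D (min x m) with hg
  have gc : Continuous g := (ff_cont D).comp (by fun_prop)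
  have gm : Monotone g := fun x y h => ff_mono D (by gcongr)
  set c0 := ff D 0
  have hc0 : 0 < c0 := ff_pos D 0
  have gc0 : ∀ x, c0 ≤ g x := fun x => ff_zero_le D _
  have gpos : ∀ x, 0 < g x := fun x => ff_pos D _
  set B := ff D m
  have gB : ∀ x, g x ≤ B := fun x => ff_mono D (min_le_right _ _)
  set L := ff D (m+1) - ff D m
  have hL : 0 ≤ L := sub_nonneg.2 (ff_mono D (by linarith))
  have gL : ∀ x y, x ≤ y → g y - g x ≤ L * (y - x) := by
    intro x y hxy
    have hh : ∀ z, ff D (max 0 z) = ff D z := fun z => by unfold ff; simp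
    simp only [hg]
    rw [← hh (min y m), ← hh (min x m)]
    have h2 : min x m ≤ min y m := by gcongr
    refine (slope_bound D hm0 (le_max_left _ _) (by gcongr) (max_le hm0 (min_le_right _ _))).trans ?_
    have h3 : max 0 (min y m) - max 0 (min x m) ≤ y - x := by
      rcases max_cases 0 (min y m) with h | h <;> rcases max_cases 0 (min x m) with h' | h' <;>
      rcases min_cases y m with h'' | h'' <;> rcases min_cases x m with h''' | h''' <;> linarith
    exact mul_le_mul_of_nonneg_left h3 hL
  obtain ⟨r0, hr0, hr⟩ := exists_r0 D (show 0 < ε/2 by linarith)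
  set G : ℝ → ℝ := fun x => ∫ s in (0:ℝ)..x, 1 / g s with hGdef
  have hG : ∀ x, HasDerivAt G (1 / g x) x := by
    intro x
    have hc : Continuous (fun s => 1 / g s) := continuous_const.div gc (fun x => (gpos x).ne')
    exact (intervalIntegral.integral_hasDerivAt_right (hc.intervalIntegrable 0 x)
      (hc.stronglyMeasurableAtFilter _ _) hc.continuousAt)
  have hG0 : G 0 = 0 := by simp [hGdef]
  have hGm : G m = FF D m := by
    simp only [hGdef, FF]
    apply intervalIntegral.integral_congr
    intro s hs
    rw [uIcc_of_le hm0] at hs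
    simp only [hg, min_eq_left hs.2]
  have hGs : StrictMono G := by
    apply strictMono_of_deriv_pos
    intro x; rw [(hG x).deriv]; have := gpos x; positivity
  -- asymptotics
  have hlog : Tendsto (fun α : ℝ => 2 * D.K * (1 - ε) / Real.log α) atTop (nhds 0) :=
    Tendsto.const_div_atTop Real.tendsto_log_atTop _
  have hlim : Tendsto (fun α : ℝ => (2 * D.K * (1 - ε) / Real.log α) * (B / (4 * c0)) +
      D.K * (1 - ε) / (1 - ε/2) * (1 + L * B * (2 * D.K * (1 - ε) / Real.log α) / c0) +
      (2 * D.K * (1 - ε) / Real.log α) * (B / r0 * ∫ s in r0..1, D.M s) / c0) atTop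
      (nhds (0 * (B / (4 * c0)) + D.K * (1 - ε) / (1 - ε/2) * (1 + L * B * 0 / c0) +
        0 * (B / r0 * ∫ s in r0..1, D.M s) / c0)) := by
    refine ((hlog.mul_const _).add (Tendsto.const_mul _ (Tendsto.const_add _ ?_))).add ((hlog.mul_const _).div_const _)
    exact (hlog.const_mul _).div_const _
  have hlt : 0 * (B / (4 * c0)) + D.K * (1 - ε) / (1 - ε/2) * (1 + L * B * 0 / c0) +
        0 * (B / r0 * ∫ s in r0..1, D.M s) / c0 < (1 - ε/2) * D.K := by
    simp
    rw [div_lt_iff₀ (by linarith)]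
    nlinarith [mul_pos hK (mul_pos h0 h0)]
  have hsq : Tendsto (fun α : ℝ => 1 / Real.sqrt α) atTop (nhds 0) :=
    Tendsto.const_div_atTop Real.tendsto_sqrt_atTop _
  filter_upwards [hlim.eventually (gt_mem_nhds hlt), eventually_gt_atTop 1,
    hsq.eventually (gt_mem_nhds hr0.1)] with α hα1 hα2 hα3
  have hα : 0 < α := by linarith
  have hla : 0 < Real.log α := Real.log_pos hα2
  set lam := 2 * D.K * (1 - ε) * α / Real.log α with hlam
  have hl : 0 < lam := by
    have : 0 < 1 - ε := by linarith
    positivity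
  refine ⟨hl, ?_⟩
  obtain ⟨u, V, t1, t2, t3, t4, t5, t6⟩ := exists_trunc D hα hl gc gm (fun x => (gpos x).le) gB
  have tr : Tr D α lam g u V := ⟨t1, t2, t3, t4, t6⟩
  have tot := tr.total hα hl gc hc0 gc0 gB hr0 hL gL t5 (by linarith : ε/2 ≤ 1/2)
    (fun r h => (hr r h).1) hG hG0 hα3.le
  have e1 : lam / α = 2 * D.K * (1 - ε) / Real.log α := by rw [hlam]; field_simp
  rw [e1] at tot
  have e2 : 2 * D.K * (1 - ε) / Real.log α / (1 - ε/2) * (1 + L * B * (2 * D.K * (1 - ε) / Real.log α) / c0) * (Real.log α / 2) =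
    D.K * (1 - ε) / (1 - ε/2) * (1 + L * B * (2 * D.K * (1 - ε) / Real.log α) / c0) := by
    have : 1 - ε/2 ≠ 0 := by linarith
    field_simp
  rw [e2] at tot
  have hum : u 0 < m := by
    apply hGs.lt_iff_lt.1
    rw [hGm]; linarith
  refine ⟨u, tr.isSol hl gc gpos ?_⟩
  intro r hr
  have : u r ≤ m := (tr.anti le_rfl hr.1 hr.2).trans hum.le
  simp only [hg, min_eq_left this]

lemma bdd (D : GelfandData) {α : ℝ} (hα : 0 < α) : BddAbove (solvableSet D α) := by
  obtain ⟨r0, hr0, hr⟩ := exists_r0 D (show (0:ℝ) < 1/2 by norm_num)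
  have hr00 := hr0.1
  have hlg : 0 < Real.log (1 + α * r0^2/4) := Real.log_pos (by
    have : 0 < α * r0^2/4 := by positivity
    linarith)
  refine ⟨D.K * (4 * α) / Real.log (1 + α * r0^2/4), ?_⟩
  rintro lam ⟨hl, u, hu⟩
  obtain ⟨v, hs⟩ := sol_of D hu
  have := hs.apriori hl.le hα le_rfl hr0.2 hr hr0.1.le le_rfl
  have h2 : 0 ≤ FF D (u r0) := by
    rw [← FF_zero D]; exact (FF_strictMono D).monotone (hs.upos _ ⟨hr0.1.le, hr0.2.le⟩)
  rw [le_div_iff₀ hlg]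
  have e : lam * (1 - 1/2) / (2 * α) * Real.log (1 + α * r0^2/4) = lam * Real.log (1 + α * r0^2/4) / (4 * α) := by
    field_simp; ring
  rw [e] at this
  have h3 : lam * Real.log (1 + α * r0^2/4) / (4 * α) ≤ D.K := by linarith
  rwa [div_le_iff₀ (by positivity)] at h3

lemma lamStar_ge (D : GelfandData) {ε : ℝ} (h0 : 0 < ε) (h1 : ε < 1) :
    ∀ᶠ α in atTop, 2 * D.K * (1 - ε) * α / Real.log α ≤ lamStar D α := by
  filter_upwards [exists_sol D h0 h1, eventually_gt_atTop 0] with α h hα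
  exact le_csSup (bdd D hα) h

lemma outer_small (D : GelfandData) {u : ℝ → ℝ → ℝ}
    (hu : ∀ᶠ α in atTop, IsSolution D α (lamStar D α) (u α)) {δ τ : ℝ} (hδ : 0 < δ) (hτ : 0 < τ) :
    ∃ r1 ∈ Ioo (0:ℝ) 1, r1 < δ ∧ ∀ᶠ α in atTop, u α r1 ≤ τ := by
  have hK := K_pos D
  have hFτ : 0 < FF D τ := by rw [← FF_zero D]; exact FF_strictMono D hτ
  set ε := min (1/2) (FF D τ / (4 * D.K)) with hε
  have hε0 : 0 < ε := by positivity
  have hε1 : ε ≤ 1/2 := min_le_left _ _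
  have hε2 : ε * (4 * D.K) ≤ FF D τ := by
    rw [← le_div_iff₀ (by positivity)]; exact min_le_right _ _
  obtain ⟨r0, hr0, hr⟩ := exists_r0 D hε0
  have hr00 := hr0.1
  set r1 := min r0 (δ/2) with hr1
  have hr10 : 0 < r1 := by positivity
  have hr11 : r1 < 1 := (min_le_left _ _).trans_lt hr0.2
  refine ⟨r1, ⟨hr10, hr11⟩, (min_le_right _ _).trans_lt (by linarith), ?_⟩
  have hlim : Tendsto (fun α : ℝ => D.K - (1 - ε)^2 * D.K * (1 + Real.log (r1^2/4) / Real.log α)) atTop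
      (nhds (D.K - (1 - ε)^2 * D.K * (1 + 0))) := by
    refine Tendsto.const_sub _ (Tendsto.const_mul _ (Tendsto.const_add _ ?_))
    exact Tendsto.const_div_atTop Real.tendsto_log_atTop _
  have hlt : D.K - (1 - ε)^2 * D.K * (1 + 0) < FF D τ := by nlinarith [mul_pos hε0 hK, mul_pos hε0 (mul_pos hε0 hK)]
  filter_upwards [hu, lamStar_ge D hε0 (by linarith), hlim.eventually (gt_mem_nhds hlt),
    eventually_gt_atTop 1] with α h1 h2 h3 h4
  have hα : 0 < α := by linarith
  have hla : 0 < Real.log α := Real.log_pos h4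
  set lam := lamStar D α
  have h1ε : 0 < 1 - ε := by linarith
  have hl : 0 ≤ lam := le_trans (by positivity) h2
  obtain ⟨v, hs⟩ := sol_of D h1
  have ap := hs.apriori hl hα hε1 hr11 (fun r h => hr r (h.trans (min_le_left _ _))) hr10.le le_rfl
  apply (FF_strictMono D).le_iff_le.1
  have hlog : Real.log α + Real.log (r1^2/4) ≤ Real.log (1 + α * r1^2/4) := by
    rw [← Real.log_mul hα.ne' (by positivity)]
    apply Real.log_le_log (by positivity)
    linarith
  have hlog0 : 0 ≤ Real.log (1 + α * r1^2/4) := Real.log_nonneg (by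
    have : 0 < α * r1^2/4 := by positivity
    linarith)
  have h5 : (1 - ε)^2 * D.K * (1 + Real.log (r1^2/4) / Real.log α) ≤
      lam * (1 - ε) / (2 * α) * Real.log (1 + α * r1^2/4) := by
    calc (1 - ε)^2 * D.K * (1 + Real.log (r1^2/4) / Real.log α)
        = (2 * D.K * (1 - ε) * α / Real.log α) * (1 - ε) / (2 * α) * (Real.log α + Real.log (r1^2/4)) := by
          field_simp
      _ ≤ (2 * D.K * (1 - ε) * α / Real.log α) * (1 - ε) / (2 * α) * Real.log (1 + α * r1^2/4) := by
          gcongr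
      _ ≤ _ := by gcongr
  linarith

lemma pw_aux {K y F η q lam : ℝ} (hK : 0 < K) (hy : 0 ≤ y) (hF : 0 < F) (hη0 : 0 ≤ η) (hη1 : η ≤ 1)
    (hq : 16 ≤ q) (hlam : K * q^4 / (4 * Real.log q) ≤ lam)
    (h : y ≤ q ∨ (3/4 ≤ η ∧ q ≤ y ∧ 128 / K * y * Real.log y ≤ F)) :
    y * (4 * q^2 + 2 * q^4 * η) ≤ 8 * q^5 + lam/4 * F * η := by
  have hq0 : 0 < q := by linarith
  have hlq0 : 0 < Real.log q := Real.log_pos (by linarith)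
  have hl : 0 < lam := lt_of_lt_of_le (by positivity) hlam
  have hq24 : 4 * q^2 ≤ 4 * q^4 := by
    have : q^2 ≤ q^4 := pow_le_pow_right₀ (by linarith) (by norm_num)
    linarith
  have hn : 0 ≤ lam/4 * F * η := by positivity
  have hq5 : 0 < q^5 := by positivity
  have hq4 : 0 < q^4 := by positivity
  rcases h with hsm | ⟨hη3, hbig, hsup⟩
  · have : y * (4 * q^2 + 2 * q^4 * η) ≤ q * (4 * q^4 + 2 * q^4 * 1) := by
      gcongr
    have e : q * (4 * q^4 + 2 * q^4 * 1) = 6 * q^5 := by ring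
    linarith
  · have hlogu : Real.log q ≤ Real.log y := Real.log_le_log hq0 hbig
    have h7 : 8 * q^4 * y ≤ lam/4 * F := by
      calc 8 * q^4 * y = (K * q^4 / (4 * Real.log q)) / 4 * (128 / K * y * Real.log q) := by
            field_simp; ring
        _ ≤ lam / 4 * (128 / K * y * Real.log y) := by gcongr
        _ ≤ lam / 4 * F := by gcongr
    have h8 : y * (4 * q^2 + 2 * q^4 * η) ≤ 8 * q^4 * y * η := by
      have : 4 * q^2 + 2 * q^4 * η ≤ 8 * q^4 * η := by
        nlinarith
      calc y * (4 * q^2 + 2 * q^4 * η) ≤ y * (8 * q^4 * η) := by gcongr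
        _ = _ := by ring
    have h9 : 8 * q^4 * y * η ≤ lam/4 * F * η := by gcongr
    linarith

set_option maxHeartbeats 2000000 in
lemma inner_small (D : GelfandData) {u : ℝ → ℝ → ℝ}
    (hu : ∀ᶠ α in atTop, IsSolution D α (lamStar D α) (u α)) :
    ∃ C0 : ℝ, 0 ≤ C0 ∧ ∀ δ > 0, ∀ᶠ α in atTop, ∃ ρ, 0 < ρ ∧ ρ < δ ∧ ρ < 1 ∧ u α ρ ≤ C0 ∧
      ∫ r in (0:ℝ)..ρ, ff D (u α r) * r ≤ δ := by
  have hK := K_pos D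
  have hm : ∃ m, 0 ≤ m ∧ (1 - 49/256) * D.K < FF D m := by
    have := (FF_tendsto D).eventually (lt_mem_nhds (show (1 - 49/256) * D.K < D.K by nlinarith))
    obtain ⟨m, h⟩ := (this.and (eventually_ge_atTop 0)).exists
    exact ⟨m, h.2, h.1⟩
  obtain ⟨C0, hC0, hC⟩ := hm
  refine ⟨C0, hC0, ?_⟩
  intro δ hδ
  obtain ⟨r0, hr0, hr⟩ := exists_r0 D (show (0:ℝ) < 1/8 by norm_num)
  have hr00 := hr0.1
  obtain ⟨s0, hs0⟩ := eventually_atTop.1 (superlin D (show 0 < 128 / D.K by positivity))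
  have hq : Tendsto (fun α : ℝ => Real.sqrt (Real.sqrt α)) atTop atTop :=
    Real.tendsto_sqrt_atTop.comp Real.tendsto_sqrt_atTop
  have hlq : Tendsto (fun q : ℝ => 256 / (3 * D.K) * (Real.log q / q)) atTop (nhds (256 / (3 * D.K) * 0)) := by
    refine Tendsto.const_mul _ ?_
    have := Real.isLittleO_log_id_atTop.tendsto_div_nhds_zero
    exact this
  rw [mul_zero] at hlq
  filter_upwards [hu, lamStar_ge D (show (0:ℝ) < 1/8 by norm_num) (by norm_num),
    eventually_gt_atTop 1, hq.eventually_ge_atTop s0, hq.eventually_ge_atTop 16,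
    hq.eventually_ge_atTop C0, hq.eventually_gt_atTop (1/r0), hq.eventually_gt_atTop (1/δ),
    hq.eventually (hlq.eventually (gt_mem_nhds hδ))]
    with α h1 h2 h4 hqs hq16 hqC hqr hqδ hqq
  have hα : 0 < α := by linarith
  set q := Real.sqrt (Real.sqrt α) with hqdef
  have hq0 : 0 < q := by linarith
  have hqα : α = q^4 := by
    have : q^4 = (q^2)^2 := by ring
    rw [this, hqdef, Real.sq_sqrt (Real.sqrt_nonneg _), Real.sq_sqrt hα.le]
  have hlogq : Real.log α = 4 * Real.log q := by rw [hqα, Real.log_pow]; norm_num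
  have hlq0 : 0 < Real.log q := Real.log_pos (by linarith)
  set lam := lamStar D α
  have h2' : D.K * q^4 / (4 * Real.log q) ≤ lam := by
    refine le_trans ?_ h2
    rw [hlogq, ← hqα]
    gcongr
    linarith
  have h2'' : D.K * (7/4) * q^4 / (4 * Real.log q) ≤ lam := by
    refine le_trans (le_of_eq ?_) h2
    rw [hlogq, ← hqα]
    ring
  have hl : 0 < lam := lt_of_lt_of_le (by positivity) h2'
  obtain ⟨v, hs⟩ := sol_of D h1
  set R := 1 / q with hR
  have hR0 : 0 < R := by positivity
  have hRr : R < r0 := by rw [hR, div_lt_iff₀ hq0]; rw [div_lt_iff₀ hr00] at hqr; linarith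
  have hRδ : R < δ := by rw [hR, div_lt_iff₀ hq0]; rw [div_lt_iff₀ hδ] at hqδ; linarith
  have hR1 : R < 1 := hRr.trans hr0.2
  have hRq : R * q = 1 := by rw [hR]; field_simp
  have huρ : u α (R/2) ≤ C0 := by
    have ap := hs.apriori hl.le hα (by norm_num : (1:ℝ)/8 ≤ 1/2) hr0.2 hr (show 0 ≤ R/2 by positivity)
      (by linarith)
    apply (FF_strictMono D).le_iff_le.1
    have e : 1 + α * (R/2)^2/4 = 1 + q^2/16 := by rw [hqα, hR]; field_simp; ring
    rw [e] at ap
    have hlog : Real.log q ≤ Real.log (1 + q^2/16) := by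
      apply Real.log_le_log hq0
      nlinarith
    have : 49/256 * D.K ≤ lam * (1 - 1/8) / (2 * α) * Real.log (1 + q^2/16) := by
      calc 49/256 * D.K ≤ (D.K * (7/4) * q^4 / (4 * Real.log q)) * (1 - 1/8) / (2 * q^4) * Real.log q := by
            apply le_of_eq; field_simp; norm_num
        _ ≤ lam * (1 - 1/8) / (2 * q^4) * Real.log (1 + q^2/16) := by
            have : (0:ℝ) ≤ 1 - 1/8 := by norm_num
            gcongr
        _ = _ := by rw [hqα]
    linarith
  refine ⟨R/2, by positivity, by linarith, by linarith, huρ, ?_⟩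
  have huc : ContinuousOn (u α) (Icc 0 R) := hs.uc.mono (Icc_subset_Icc_right hR1.le)
  have hfc : ContinuousOn (fun r => ff D (u α r)) (Icc 0 R) := (ff_cont D).comp_continuousOn huc
  have hpc := (ps_cont D).continuousOn (s := Icc 0 R)
  have tst := hs.test hl.le hα hR0 hR1
  have pw : ∀ r ∈ Icc 0 R, (lam/4 * ff D (u α r) * (1 - r^2/R^2) - 8 * q^5) * r ≤ lam * ps D r * ff D (u α r) * (1 - r^2/R^2) * r
      - u α r * r * (4/R^2 + 2 * α * (1 - r^2/R^2)) := by
    intro r hrR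
    have hf := ff_pos D (u α r)
    have hup := hs.upos r ⟨hrR.1, hrR.2.trans hR1.le⟩
    have hps := (hr r (hrR.2.trans hRr.le)).2
    set η := 1 - r^2/R^2 with hη
    have hη0 : 0 ≤ η := by
      rw [hη, sub_nonneg, div_le_one (by positivity)]
      have := hrR.1
      have := hrR.2
      gcongr
    have hη1 : η ≤ 1 := by rw [hη]; linarith [show 0 ≤ r^2/R^2 by positivity]
    have eR : 4 / R^2 = 4 * q^2 := by rw [hR]; field_simp
    have eα : 2 * α * η = 2 * q^4 * η := congrArg (fun x => 2 * x * η) hqα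
    have main : u α r * (4/R^2 + 2 * α * η) ≤ 8 * q^5 + lam/4 * ff D (u α r) * η := by
      rw [eR, eα]
      refine pw_aux hK hup hf hη0 hη1 hq16 h2' ?_
      rcases le_total (u α r) q with hsm | hbig
      · exact Or.inl hsm
      rcases le_total (R/2) r with hrr | hrr
      · left
        refine le_trans ?_ hqC
        exact (hs.anti hl.le ⟨by positivity, by linarith⟩ ⟨hrR.1, hrR.2.trans hR1.le⟩ hrr).trans huρ
      · right
        have hη3 : 3/4 ≤ η := by
          have : r^2/R^2 ≤ 1/4 := by
            rw [div_le_iff₀ (by positivity)]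
            nlinarith [hrR.1]
          rw [hη]; linarith
        exact ⟨hη3, hbig, hs0 (u α r) (hqs.trans hbig)⟩
    have h10 : lam/2 * ff D (u α r) * η ≤ lam * ps D r * ff D (u α r) * η := by
      have : lam/2 ≤ lam * ps D r := by nlinarith
      gcongr
    have h11 : lam/4 * ff D (u α r) * η - 8 * q^5 ≤ lam * ps D r * ff D (u α r) * η - u α r * (4/R^2 + 2 * α * η) := by
      linarith
    have := mul_le_mul_of_nonneg_right h11 hrR.1
    linarith
  have I1c : ContinuousOn (fun r => lam/4 * ff D (u α r) * (1 - r^2/R^2) * r) (Icc 0 R) := by fun_prop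
  have I1 : IntervalIntegrable (fun r => lam/4 * ff D (u α r) * (1 - r^2/R^2) * r) volume 0 R := by
    apply ContinuousOn.intervalIntegrable; rwa [uIcc_of_le hR0.le]
  have I2 : IntervalIntegrable (fun r => (lam/4 * ff D (u α r) * (1 - r^2/R^2) - 8 * q^5) * r) volume 0 R := by
    apply ContinuousOn.intervalIntegrable; rw [uIcc_of_le hR0.le]; fun_prop
  have I3 : IntervalIntegrable (fun r => lam * ps D r * ff D (u α r) * (1 - r^2/R^2) * r
      - u α r * r * (4/R^2 + 2 * α * (1 - r^2/R^2))) volume 0 R := by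
    apply ContinuousOn.intervalIntegrable; rw [uIcc_of_le hR0.le]; fun_prop
  have J1 := (intervalIntegral.integral_mono_on hR0.le I2 I3 pw).trans tst
  have J2 : ∫ r in (0:ℝ)..R, (lam/4 * ff D (u α r) * (1 - r^2/R^2) - 8 * q^5) * r =
      (∫ r in (0:ℝ)..R, lam/4 * ff D (u α r) * (1 - r^2/R^2) * r) - 8 * q^5 * (R^2/2) := by
    have : ∀ r, (lam/4 * ff D (u α r) * (1 - r^2/R^2) - 8 * q^5) * r =
      lam/4 * ff D (u α r) * (1 - r^2/R^2) * r - 8 * q^5 * r := fun r => by ring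
    simp only [this]
    rw [intervalIntegral.integral_sub I1 (Continuous.intervalIntegrable (by fun_prop) _ _),
      intervalIntegral.integral_const_mul, integral_id]
    ring
  have hnn : ∀ r ∈ Icc 0 R, 0 ≤ lam/4 * ff D (u α r) * (1 - r^2/R^2) * r := by
    intro r hrR
    have hf := ff_pos D (u α r)
    have hη0 : 0 ≤ 1 - r^2/R^2 := by
      rw [sub_nonneg, div_le_one (by positivity)]
      have := hrR.1
      have := hrR.2
      gcongr
    have := hrR.1
    positivity
  have I4 : IntervalIntegrable (fun r => lam/4 * ff D (u α r) * (1 - r^2/R^2) * r) volume 0 (R/2) :=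
    I1.mono_set (by rw [uIcc_of_le hR0.le, uIcc_of_le (by positivity)]; exact Icc_subset_Icc_right (by linarith))
  have I5 : IntervalIntegrable (fun r => lam/4 * ff D (u α r) * (1 - r^2/R^2) * r) volume (R/2) R :=
    I1.mono_set (by rw [uIcc_of_le hR0.le, uIcc_of_le (by linarith)]; exact Icc_subset_Icc_left (by linarith))
  have J3 : ∫ r in (0:ℝ)..(R/2), lam/4 * ff D (u α r) * (1 - r^2/R^2) * r ≤
      ∫ r in (0:ℝ)..R, lam/4 * ff D (u α r) * (1 - r^2/R^2) * r := by
    rw [← intervalIntegral.integral_add_adjacent_intervals I4 I5]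
    have : 0 ≤ ∫ r in (R/2)..R, lam/4 * ff D (u α r) * (1 - r^2/R^2) * r :=
      intervalIntegral.integral_nonneg (by linarith) (fun r hr => hnn r ⟨by linarith [hr.1], hr.2⟩)
    linarith
  have J4 : ∫ r in (0:ℝ)..(R/2), 3 * lam/16 * (ff D (u α r) * r) ≤
      ∫ r in (0:ℝ)..(R/2), lam/4 * ff D (u α r) * (1 - r^2/R^2) * r := by
    apply intervalIntegral.integral_mono_on (by positivity) _ I4
    · intro r hrr
      have hf := ff_pos D (u α r)
      have hη3 : 3/4 ≤ 1 - r^2/R^2 := by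
        have : r^2/R^2 ≤ 1/4 := by
          rw [div_le_iff₀ (by positivity)]
          nlinarith [hrr.1, hrr.2]
        linarith
      have h0 := hrr.1
      calc 3 * lam/16 * (ff D (u α r) * r) = lam/4 * ff D (u α r) * (3/4) * r := by ring
        _ ≤ _ := by gcongr
    · apply ContinuousOn.intervalIntegrable
      rw [uIcc_of_le (by positivity)]
      have := hfc.mono (Icc_subset_Icc_right (show R/2 ≤ R by linarith))
      fun_prop
  rw [intervalIntegral.integral_const_mul] at J4
  rw [J2] at J1
  have e5 : 8 * q^5 * (R^2/2) = 4 * q^3 := by rw [hR]; field_simp; norm_num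
  set J := ∫ r in (0:ℝ)..(R/2), ff D (u α r) * r with hJ
  have hJ0 : 0 ≤ J := intervalIntegral.integral_nonneg (by positivity) (fun r hr => by
    have := hr.1
    have := ff_pos D (u α r)
    positivity)
  have J5 : 3 * lam / 16 * J ≤ 4 * q^3 := by linarith
  have J6 : 3 * (D.K * q^4 / (4 * Real.log q)) / 16 * J ≤ 4 * q^3 := by
    refine le_trans ?_ J5
    gcongr
  have J7 : J ≤ 256 / (3 * D.K) * (Real.log q / q) := by
    have hp : 0 < 3 * (D.K * q^4 / (4 * Real.log q)) / 16 := by positivity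
    refine le_of_mul_le_mul_left (J6.trans (le_of_eq ?_)) hp
    field_simp; norm_num
  linarith

lemma generic (D : GelfandData) {u : ℝ → ℝ → ℝ}
    (hu : ∀ᶠ α in atTop, IsSolution D α (lamStar D α) (u α)) {h w : ℝ → ℝ} {c : ℝ}
    (hc : Continuous h) (hm : MonotoneOn h (Ici 0)) (h0 : h 0 = 0) (hc0 : 0 ≤ c)
    (hle : ∀ x, 0 ≤ x → h x ≤ c * ff D x) (wc : Continuous w) (w0 : ∀ x, 0 ≤ w x) (w1 : ∀ x, w x ≤ 1) :
    Tendsto (fun α => ∫ r in Ioo (0:ℝ) 1, w r * h (u α r) * r) atTop (nhds 0) := by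
  obtain ⟨C0, hC0, hin⟩ := inner_small D hu
  have hnn : ∀ x, 0 ≤ x → 0 ≤ h x := fun x hx => by
    rw [← h0]; exact hm (by simp) hx hx
  rw [Metric.tendsto_nhds]
  intro e he
  -- choose τ
  obtain ⟨τ, hτ, hhτ⟩ : ∃ τ > 0, h τ < e/4 := by
    have h1 : ∀ᶠ x in nhdsWithin (0:ℝ) (Ioi 0), h x < e/4 := by
      have := (hc.tendsto 0).mono_left (nhdsWithin_le_nhds (s := Ioi 0))
      apply this.eventually (gt_mem_nhds _)
      rw [h0]; linarith
    obtain ⟨τ, h2, h3⟩ := (h1.and self_mem_nhdsWithin).exists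
    exact ⟨τ, h3, h2⟩
  have hhC := hnn C0 hC0
  obtain ⟨r1, hr1, hr1δ, hout⟩ := outer_small D hu (show 0 < e / (4 * (h C0 + 1)) by positivity) hτ
  have hr10 := hr1.1
  filter_upwards [hu, hout, hin (min r1 (e / (4 * (c + 1)))) (by positivity), 
    lamStar_ge D (show (0:ℝ) < 1/2 by norm_num) (by norm_num), eventually_gt_atTop 1] with α h1 h2 h3 h4 h5
  obtain ⟨ρ, hρ0, hρδ, hρ1, hρC, hρI⟩ := h3
  have hρr : ρ < r1 := hρδ.trans_le (min_le_left _ _)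
  obtain ⟨v, hs⟩ := sol_of D h1
  have hK := K_pos D
  have hl : 0 ≤ lamStar D α := by
    refine le_trans ?_ h4
    have := Real.log_pos h5
    have : 0 < α := by linarith
    have : (0:ℝ) < 1 - 1/2 := by norm_num
    positivity
  have huc := hs.uc
  have hhc : ContinuousOn (fun r => h (u α r)) (Icc 0 1) := hc.comp_continuousOn huc
  have hfc : ContinuousOn (fun r => ff D (u α r)) (Icc 0 1) := (ff_cont D).comp_continuousOn huc
  set k : ℝ → ℝ := fun r => w r * h (u α r) * r with hk
  have hkc : ContinuousOn k (Icc 0 1) := by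
    have := wc.continuousOn (s := Icc 0 1)
    rw [hk]; fun_prop
  have hkI : ∀ a b, 0 ≤ a → a ≤ b → b ≤ 1 → IntervalIntegrable k volume a b := by
    intro a b ha hab hb
    apply ContinuousOn.intervalIntegrable
    rw [uIcc_of_le hab]
    exact hkc.mono (Icc_subset_Icc ha hb)
  have hk0 : ∀ r ∈ Icc (0:ℝ) 1, 0 ≤ k r := by
    intro r hr
    have := hnn _ (hs.upos r hr)
    have := w0 r
    have := hr.1
    positivity
  have hkle : ∀ r ∈ Icc (0:ℝ) 1, k r ≤ h (u α r) * r := by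
    intro r hr
    have h1 := hnn _ (hs.upos r hr)
    have := w1 r
    have := hr.1
    calc k r = w r * (h (u α r) * r) := by rw [hk]; ring
      _ ≤ 1 * (h (u α r) * r) := by gcongr
      _ = _ := one_mul _
  have e1 : ∫ r in Ioo (0:ℝ) 1, k r = ∫ r in (0:ℝ)..1, k r := by
    rw [intervalIntegral.integral_of_le zero_le_one, integral_Ioc_eq_integral_Ioo]
  have hpos : 0 ≤ ∫ r in (0:ℝ)..1, k r := intervalIntegral.integral_nonneg zero_le_one hk0
  change dist (∫ r in Ioo (0:ℝ) 1, k r) 0 < e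
  rw [e1, Real.dist_eq, sub_zero, abs_of_nonneg hpos,
    ← intervalIntegral.integral_add_adjacent_intervals (hkI 0 r1 le_rfl hr10.le hr1.2.le)
      (hkI r1 1 hr10.le hr1.2.le le_rfl),
    ← intervalIntegral.integral_add_adjacent_intervals (hkI 0 ρ le_rfl hρ0.le hρ1.le)
      (hkI ρ r1 hρ0.le hρr.le hr1.2.le)]
  have b1 : ∫ r in (0:ℝ)..ρ, k r ≤ c * ∫ r in (0:ℝ)..ρ, ff D (u α r) * r := by
    rw [← intervalIntegral.integral_const_mul]
    apply intervalIntegral.integral_mono_on hρ0.le (hkI 0 ρ le_rfl hρ0.le hρ1.le)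
    · apply ContinuousOn.intervalIntegrable
      rw [uIcc_of_le hρ0.le]
      have := hfc.mono (Icc_subset_Icc_right hρ1.le)
      fun_prop
    · intro r hr
      have hr' : r ∈ Icc (0:ℝ) 1 := ⟨hr.1, hr.2.trans hρ1.le⟩
      refine (hkle r hr').trans ?_
      rw [← mul_assoc]
      exact mul_le_mul_of_nonneg_right (hle _ (hs.upos r hr')) hr.1
  have cst : ∀ a b x, 0 < a → a ≤ b → b ≤ 1 → 0 ≤ x → u α a ≤ x → ∫ r in a..b, k r ≤ h x * (b - a) := by
    intro a b x ha hab hb hx hux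
    have : ∫ r in a..b, k r ≤ ∫ r in a..b, h x := by
      apply intervalIntegral.integral_mono_on hab (hkI a b ha.le hab hb) intervalIntegrable_const
      intro r hr
      have hr' : r ∈ Icc (0:ℝ) 1 := ⟨ha.le.trans hr.1, hr.2.trans hb⟩
      have hur := hs.upos r hr'
      have h7 : u α r ≤ x := (hs.anti hl ⟨ha.le, hab.trans hb⟩ hr' hr.1).trans hux
      have h8 := hm hur hx h7
      have h9 := hnn _ hur
      have h10 := hkle r hr'
      have h11 := hr'.2
      nlinarith
    rw [intervalIntegral.integral_const, smul_eq_mul] at this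
    linarith
  have b2 := cst ρ r1 C0 hρ0 hρr.le hr1.2.le hC0 hρC
  have b3 := cst r1 1 τ hr10 hr1.2.le le_rfl hτ.le h2
  have b4 : c * ∫ r in (0:ℝ)..ρ, ff D (u α r) * r ≤ e/4 := by
    have h6 := hρI.trans (min_le_right _ _)
    calc c * ∫ r in (0:ℝ)..ρ, ff D (u α r) * r ≤ c * (e / (4 * (c+1))) := by gcongr
      _ ≤ (c+1) * (e / (4 * (c+1))) := by gcongr; linarith
      _ = e/4 := by field_simp
  have b5 : h C0 * (r1 - ρ) ≤ e/4 := by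
    calc h C0 * (r1 - ρ) ≤ (h C0 + 1) * (e / (4 * (h C0 + 1))) := by
          apply mul_le_mul (by linarith) (by linarith) (by linarith) (by linarith)
      _ = e/4 := by field_simp
  have b6 : h τ * (1 - r1) ≤ e/4 := by
    have := hnn τ hτ.le
    nlinarith
  linarith

end Gel

/-- If `u_α` is a solution of `(P_{α, λ*(α)})` for every sufficiently
large `α`, then `∫₀¹ u_α(r) r dr → 0` and
`∫₀¹ ψ(r) f(u_α(r)) r dr → f(0) ∫₀¹ ψ(r) r dr` as `α → ∞`. -/
theorem extremal_integral_limit (D : GelfandData) (u : ℝ → ℝ → ℝ)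
    (hu : ∀ᶠ α in atTop, IsSolution D α (lamStar D α) (u α)) :
    Tendsto (fun α => ∫ r in Ioo (0:ℝ) 1, u α r * r) atTop (nhds 0) ∧
      Tendsto (fun α => ∫ r in Ioo (0:ℝ) 1, D.psi r * D.f (u α r) * r) atTop
        (nhds (D.f 0 * ∫ r in Ioo (0:ℝ) 1, D.psi r * r)) := by
  constructor
  · have := Gel.generic D hu (h := fun x => x) (w := fun _ => 1) (c := D.K) continuous_id
      (fun x _ y _ h => h) rfl (Gel.K_pos D).le
      (fun x hx => by
        have h1 := (Gel.FF_ge D hx).trans (Gel.FF_lt D x).le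
        rwa [div_le_iff₀ (Gel.ff_pos D x)] at h1)
      continuous_const (fun _ => zero_le_one) (fun _ => le_rfl)
    simpa using this
  · have h0 : Gel.ff D 0 = D.f 0 := Gel.ff_eq D le_rfl
    have := Gel.generic D hu (h := fun x => Gel.ff D x - Gel.ff D 0) (w := Gel.ps D) (c := 1)
      ((Gel.ff_cont D).sub continuous_const)
      (fun x _ y _ h => sub_le_sub_right (Gel.ff_mono D h) _) (sub_self _) zero_le_one
      (fun x hx => by linarith [Gel.ff_pos D 0])
      (Gel.ps_cont D) (Gel.ps_nonneg D) (Gel.ps_le D)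
    have h2 := this.add_const (D.f 0 * ∫ r in Ioo (0:ℝ) 1, D.psi r * r)
    rw [zero_add] at h2
    refine h2.congr' ?_
    filter_upwards [hu] with α hα
    obtain ⟨v, hs⟩ := Gel.sol_of D hα
    have huc := hs.uc
    have hfc : ContinuousOn (fun r => Gel.ff D (u α r)) (Icc 0 1) :=
      (Gel.ff_cont D).comp_continuousOn huc
    have hpc := (Gel.ps_cont D).continuousOn (s := Icc 0 1)
    have c1 : IntegrableOn (fun r => Gel.ps D r * (Gel.ff D (u α r) - Gel.ff D 0) * r) (Ioo 0 1) := by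
      have : ContinuousOn (fun r => Gel.ps D r * (Gel.ff D (u α r) - Gel.ff D 0) * r) (Icc 0 1) := by
        fun_prop
      exact this.integrableOn_Icc.mono_set Ioo_subset_Icc_self
    have c2 : IntegrableOn (fun r => D.f 0 * (D.psi r * r)) (Ioo 0 1) := by
      have : ContinuousOn (fun r => D.f 0 * (Gel.ps D r * r)) (Icc 0 1) := by
        fun_prop
      refine (this.integrableOn_Icc.mono_set Ioo_subset_Icc_self).congr_fun ?_ measurableSet_Ioo
      intro r hr
      simp only [Gel.ps_eq D (Ioo_subset_Icc_self hr)]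
    rw [← integral_const_mul, ← integral_add c1 c2]
    apply setIntegral_congr_fun measurableSet_Ioo
    intro r hr
    have hr' := Ioo_subset_Icc_self hr
    simp only [Gel.ps_eq D hr', Gel.ff_eq D (hs.upos r hr'), h0]
    ring
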